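/- arXiv:1509.06191 — 4 statements merged into one kernel-verified Lean document; each statement's English description precedes it below -/
import Mathlib

section
/- There exists an absolute constant C ≥ 0 with the following property. Let Ω be a finite set, ℓ ≥ 2, and let P be an ℓ-step probability distribution on Ω^ℓ with equal marginals π, with ρ(P) ≤ ρ < 1 and min_{x∈Ω} π(x) ≥ α > 0. For every ε ∈ (0,1/2], set τ := ((1−ρ²)ε/ℓ^{5/2})^{C·ℓ·ln(ℓ/ε)·ln(1/α)/((1−ρ)ε)}. Then for every n ≥ 1 and all functions f^{(1)},…,f^{(ℓ)} : Ωⁿ → [0,1] with max_{i∈[n], j∈[ℓ]} Inf_i(f^{(j)}(X^{(j)})) ≤ τ, writing μ^{(j)} := E[f^{(j)}(X^{(j)})], one has E[∏_{j=1}^ℓ f^{(j)}(X^{(j)})] ≥ (∏_{j=1}^ℓ μ^{(j)})^{ℓ/(1−ρ²)} − ε. -/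
namespace SameSetHitting

/-- `P` is a probability distribution on a finite type. -/
def IsDist {α : Type} [Fintype α] (P : α → ℝ) : Prop :=
  (∀ x, 0 ≤ P x) ∧ ∑ x, P x = 1

open Classical in
/-- The `j`-th marginal of an `ℓ`-step distribution `P`. -/
noncomputable def marginal {Ω : Type} [Fintype Ω] {ℓ : ℕ}
    (P : (Fin ℓ → Ω) → ℝ) (j : Fin ℓ) (a : Ω) : ℝ :=
  ∑ x : Fin ℓ → Ω, if x j = a then P x else 0

/-- All `ℓ` marginals of `P` are equal to `π`. -/
def HasMarginals {Ω : Type} [Fintype Ω] {ℓ : ℕ}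
    (P : (Fin ℓ → Ω) → ℝ) (π : Ω → ℝ) : Prop :=
  ∀ j a, marginal P j a = π a

/-- The expectation `E[f(X)]` where `X` has the product law `πⁿ`. -/
noncomputable def exps {Ω : Type} [Fintype Ω] {n : ℕ}
    (π : Ω → ℝ) (f : (Fin n → Ω) → ℝ) : ℝ :=
  ∑ v : Fin n → Ω, (∏ i, π (v i)) * f v

/-- `E[∏_{j} f_j(X^{(j)})]` where the tuples `(X_i^{(1)}, …, X_i^{(ℓ)})`,
`i = 1, …, n`, are i.i.d. with law `P` and `X^{(j)} = (X_1^{(j)}, …, X_n^{(j)})`. -/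
noncomputable def prodExp {Ω : Type} [Fintype Ω] {ℓ n : ℕ}
    (P : (Fin ℓ → Ω) → ℝ) (f : Fin ℓ → ((Fin n → Ω) → ℝ)) : ℝ :=
  ∑ x : Fin ℓ → Fin n → Ω, (∏ i, P (fun j => x j i)) * ∏ j, f j (x j)

/-- Expectation under the single-coordinate multi-step distribution `P`. -/
noncomputable def expP {Ω : Type} [Fintype Ω] {ℓ : ℕ}
    (P : (Fin ℓ → Ω) → ℝ) (f : (Fin ℓ → Ω) → ℝ) : ℝ :=
  ∑ x, P x * f x

/-- Covariance under `P`. -/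
noncomputable def covP {Ω : Type} [Fintype Ω] {ℓ : ℕ}
    (P : (Fin ℓ → Ω) → ℝ) (f g : (Fin ℓ → Ω) → ℝ) : ℝ :=
  expP P (fun x => f x * g x) - expP P f * expP P g

/-- Variance under `P`. -/
noncomputable def varP {Ω : Type} [Fintype Ω] {ℓ : ℕ}
    (P : (Fin ℓ → Ω) → ℝ) (f : (Fin ℓ → Ω) → ℝ) : ℝ :=
  covP P f f

/-- `f` depends only on the coordinates in `S`. -/
def DependsOn {Ω : Type} {ℓ : ℕ} (f : (Fin ℓ → Ω) → ℝ) (S : Finset (Fin ℓ)) : Prop :=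
  ∀ x y : Fin ℓ → Ω, (∀ j ∈ S, x j = y j) → f x = f y

/-- The correlation `ρ(P, S, T)`. -/
noncomputable def rhoST {Ω : Type} [Fintype Ω] {ℓ : ℕ}
    (P : (Fin ℓ → Ω) → ℝ) (S T : Finset (Fin ℓ)) : ℝ :=
  sSup {r : ℝ | ∃ f g : (Fin ℓ → Ω) → ℝ, DependsOn f S ∧ DependsOn g T ∧
    varP P f = 1 ∧ varP P g = 1 ∧ r = covP P f g}

/-- The correlation `ρ(P) = max_j ρ(P, {j}, [ℓ]∖{j})`. -/
noncomputable def rho {Ω : Type} [Fintype Ω] {ℓ : ℕ} (P : (Fin ℓ → Ω) → ℝ) : ℝ :=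
  ⨆ j : Fin ℓ, rhoST P {j} ({j}ᶜ)

/-- Expectation under the single-step distribution `π`. -/
noncomputable def expPi {Ω : Type} [Fintype Ω] (π : Ω → ℝ) (f : Ω → ℝ) : ℝ :=
  ∑ a, π a * f a

/-- Variance under the single-step distribution `π`. -/
noncomputable def varPi {Ω : Type} [Fintype Ω] (π : Ω → ℝ) (f : Ω → ℝ) : ℝ :=
  expPi π (fun a => (f a - expPi π f) ^ 2)

/-- The influence `Inf_i(f(X))` of coordinate `i`, where `X` has product law `πⁿ`. -/
noncomputable def influence {Ω : Type} [Fintype Ω] {n : ℕ}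
    (π : Ω → ℝ) (i : Fin n) (f : (Fin n → Ω) → ℝ) : ℝ :=
  ∑ v : Fin n → Ω, (∏ k, π (v k)) * varPi π (fun a => f (Function.update v i a))

/-- The function obtained from `f` by applying the restriction `R`
(`none` means unrestricted). -/
def restrict {Ω : Type} {n : ℕ} (R : Fin n → Option Ω)
    (f : (Fin n → Ω) → ℝ) : (Fin n → Ω) → ℝ :=
  fun x => f (fun i => (R i).getD (x i))

/-- The size (number of restricted coordinates) of a restriction. -/
def restSize {Ω : Type} {n : ℕ} (R : Fin n → Option Ω) : ℕ :=
  (Finset.univ.filter (fun i => (R i).isSome = true)).card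

/-- `f` is `ε`-resilient up to size `k` (with respect to the product law `πⁿ`). -/
def Resilient {Ω : Type} [Fintype Ω] {n : ℕ} (π : Ω → ℝ) (ε : ℝ) (k : ℕ)
    (f : (Fin n → Ω) → ℝ) : Prop :=
  ∀ R : Fin n → Option Ω, restSize R ≤ k →
    (1 - ε) * exps π f ≤ exps π (restrict R f) ∧
    exps π (restrict R f) ≤ (1 + ε) * exps π f

/-- The restriction operator `R[i,a]`. -/
def restrOp {Ω : Type} {n : ℕ} (i : Fin n) (a : Ω)
    (f : (Fin n → Ω) → ℝ) : (Fin n → Ω) → ℝ :=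
  fun x => f (Function.update x i a)

/-- The maximum operator `M[i,y,z]`. -/
def maxOp {Ω : Type} {n : ℕ} (i : Fin n) (y z : Ω)
    (f : (Fin n → Ω) → ℝ) : (Fin n → Ω) → ℝ :=
  fun x => max (f (Function.update x i y)) (f (Function.update x i z))

/-- Insert the value `a` at position `j` into `w : Ω^{[ℓ] ∖ {j}}`. -/
def ins {Ω : Type} {ℓ : ℕ} (j : Fin ℓ) (w : {k : Fin ℓ // k ≠ j} → Ω) (a : Ω) :
    Fin ℓ → Ω :=
  fun k => if h : k = j then a else w ⟨k, h⟩

/-- The probability that the coordinates other than `j` equal `w`. -/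
noncomputable def margOff {Ω : Type} [Fintype Ω] {ℓ : ℕ}
    (P : (Fin ℓ → Ω) → ℝ) (j : Fin ℓ) (w : {k : Fin ℓ // k ≠ j} → Ω) : ℝ :=
  ∑ a, P (ins j w a)

open Classical in
/-- The joint law of `(Y, Z)` for a double sample on step `j` from `P`. -/
noncomputable def doubleSample {Ω : Type} [Fintype Ω] {ℓ : ℕ}
    (P : (Fin ℓ → Ω) → ℝ) (j : Fin ℓ) (y z : Ω) : ℝ :=
  ∑ w : {k : Fin ℓ // k ≠ j} → Ω,
    if margOff P j w = 0 then 0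
    else P (ins j w y) * P (ins j w z) / margOff P j w


set_option linter.unusedVariables false
set_option linter.unusedSectionVars false

/-! ### Elementary facts about `exps` -/

section Basics

variable {Ω : Type} [Fintype Ω]

lemma exps_zero (π : Ω → ℝ) (f : (Fin 0 → Ω) → ℝ) (v : Fin 0 → Ω) : exps π f = f v := by
  unfold exps
  rw [Fintype.sum_eq_single v]
  · simp
  · intro x hx
    exact absurd (Subsingleton.elim x v) hx

lemma exps_succ {n : ℕ} (π : Ω → ℝ) (f : (Fin (n+1) → Ω) → ℝ) :
    exps π f = ∑ a, π a * exps π (fun v : Fin n → Ω => f (Fin.cons a v)) := by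
  unfold exps
  rw [← (Fin.consEquiv (fun _ => Ω)).sum_comp, Fintype.sum_prod_type]
  refine Finset.sum_congr rfl fun a _ => ?_
  rw [Finset.mul_sum]
  refine Finset.sum_congr rfl fun v _ => ?_
  simp [Fin.consEquiv, Fin.prod_univ_succ, mul_assoc]

lemma exps_mono {n : ℕ} {π : Ω → ℝ} (hπ : ∀ a, 0 ≤ π a) {f g : (Fin n → Ω) → ℝ}
    (h : ∀ v, f v ≤ g v) : exps π f ≤ exps π g :=
  Finset.sum_le_sum fun v _ =>
    mul_le_mul_of_nonneg_left (h v) (Finset.prod_nonneg fun i _ => hπ _)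

lemma exps_add {n : ℕ} (π : Ω → ℝ) (f g : (Fin n → Ω) → ℝ) :
    exps π (fun v => f v + g v) = exps π f + exps π g := by
  simp only [exps, mul_add, Finset.sum_add_distrib]

lemma exps_sub {n : ℕ} (π : Ω → ℝ) (f g : (Fin n → Ω) → ℝ) :
    exps π (fun v => f v - g v) = exps π f - exps π g := by
  simp only [exps, mul_sub, Finset.sum_sub_distrib]

lemma exps_smul {n : ℕ} (π : Ω → ℝ) (c : ℝ) (f : (Fin n → Ω) → ℝ) :
    exps π (fun v => c * f v) = c * exps π f := by
  simp only [exps, Finset.mul_sum]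
  exact Finset.sum_congr rfl fun v _ => by ring

lemma exps_sum {n : ℕ} {B : Type} [Fintype B] (π : Ω → ℝ) (F : B → (Fin n → Ω) → ℝ) :
    exps π (fun v => ∑ b, F b v) = ∑ b, exps π (F b) := by
  simp only [exps, Finset.mul_sum]
  exact Finset.sum_comm

lemma exps_wsum {n : ℕ} {B : Type} [Fintype B] (π : Ω → ℝ) (c : B → ℝ)
    (F : B → (Fin n → Ω) → ℝ) :
    exps π (fun v => ∑ b, c b * F b v) = ∑ b, c b * exps π (F b) := by
  rw [exps_sum]
  exact Finset.sum_congr rfl fun b _ => exps_smul _ _ _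

lemma exps_const {n : ℕ} {π : Ω → ℝ} (h1 : ∑ a, π a = 1) (c : ℝ) :
    exps π (fun _ : Fin n → Ω => c) = c := by
  induction n with
  | zero => exact exps_zero _ _ (fun i => i.elim0)
  | succ n ih => rw [exps_succ]; simp only [ih]; rw [← Finset.sum_mul, h1, one_mul]

lemma exps_nonneg {n : ℕ} {π : Ω → ℝ} (hπ : ∀ a, 0 ≤ π a) {f : (Fin n → Ω) → ℝ}
    (h : ∀ v, 0 ≤ f v) : 0 ≤ exps π f :=
  Finset.sum_nonneg fun v _ => mul_nonneg (Finset.prod_nonneg fun i _ => hπ _) (h v)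

/-- weighted Cauchy-Schwarz -/
lemma wcs {B : Type} [Fintype B] {w : B → ℝ} (hw : ∀ b, 0 ≤ w b) (f g : B → ℝ) :
    (∑ b, w b * (f b * g b)) ^ 2 ≤ (∑ b, w b * f b ^ 2) * ∑ b, w b * g b ^ 2 := by
  have := Finset.sum_mul_sq_le_sq_mul_sq Finset.univ (fun b => √(w b) * f b)
    (fun b => √(w b) * g b)
  have e : ∀ b, √(w b) * √(w b) = w b := fun b => Real.mul_self_sqrt (hw b)
  have e1 : ∑ b, √(w b) * f b * (√(w b) * g b) = ∑ b, w b * (f b * g b) :=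
    Finset.sum_congr rfl fun b _ => by
      calc √(w b) * f b * (√(w b) * g b) = (√(w b) * √(w b)) * (f b * g b) := by ring
        _ = _ := by rw [e]
  have e2 : ∀ h : B → ℝ, ∑ b, (√(w b) * h b) ^ 2 = ∑ b, w b * h b ^ 2 := fun h =>
    Finset.sum_congr rfl fun b _ => by rw [mul_pow, Real.sq_sqrt (hw b)]
  rw [e1, e2, e2] at this
  exact this

lemma exps_cs {n : ℕ} {π : Ω → ℝ} (hπ : ∀ a, 0 ≤ π a) (f g : (Fin n → Ω) → ℝ) :
    (exps π (fun v => f v * g v)) ^ 2 ≤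
      exps π (fun v => f v ^ 2) * exps π (fun v => g v ^ 2) :=
  wcs (w := fun v : Fin n → Ω => ∏ i, π (v i)) (fun v => Finset.prod_nonneg fun i _ => hπ _) f g

/-- Jensen for squares -/
lemma wjensen {w : Ω → ℝ} (hw : ∀ b, 0 ≤ w b) (h1 : ∑ a, w a = 1) (f : Ω → ℝ) :
    (∑ b, w b * f b) ^ 2 ≤ ∑ b, w b * f b ^ 2 := by
  have := wcs hw f (fun _ => 1)
  simpa [h1] using this

lemma marg_sum {ℓ : ℕ} {P : (Fin ℓ → Ω) → ℝ} {π : Ω → ℝ} (hm : HasMarginals P π) (j : Fin ℓ)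
    (u : Ω → ℝ) : ∑ y, P y * u (y j) = ∑ a, π a * u a := by
  classical
  simp only [← hm j, marginal, Finset.sum_mul]
  rw [Finset.sum_comm]
  refine Finset.sum_congr rfl fun y _ => ?_
  simp

lemma cons_proj {ℓ n : ℕ} (y : Fin ℓ → Ω) (x : Fin n → Fin ℓ → Ω) (j : Fin ℓ) :
    (fun i => (Fin.cons y x : Fin (n+1) → Fin ℓ → Ω) i j)
      = (Fin.cons (y j) (fun i => x i j) : Fin (n+1) → Ω) := by
  funext i
  refine Fin.cases ?_ (fun i => ?_) i <;> simp

lemma exps_marg {ℓ : ℕ} {P : (Fin ℓ → Ω) → ℝ} {π : Ω → ℝ} (hm : HasMarginals P π) (j : Fin ℓ)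
    {n : ℕ} (h : (Fin n → Ω) → ℝ) :
    exps P (fun x : Fin n → Fin ℓ → Ω => h (fun i => x i j)) = exps π h := by
  induction n with
  | zero =>
    rw [exps_zero _ _ (fun i => i.elim0), exps_zero _ _ (fun i => i.elim0)]
    congr 1
    funext i
    exact i.elim0
  | succ n ih =>
    rw [exps_succ, exps_succ]
    simp only [cons_proj]
    have : ∀ y : Fin ℓ → Ω, exps P (fun x : Fin n → Fin ℓ → Ω =>
        h (Fin.cons (y j) (fun i => x i j))) = exps π (fun v => h (Fin.cons (y j) v)) :=
      fun y => ih (fun v => h (Fin.cons (y j) v))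
    simp only [this]
    exact marg_sum hm j (fun a => exps π (fun v => h (Fin.cons a v)))

lemma prodExp_eq {ℓ n : ℕ} (P : (Fin ℓ → Ω) → ℝ) (f : Fin ℓ → ((Fin n → Ω) → ℝ)) :
    prodExp P f = exps P (fun x : Fin n → Fin ℓ → Ω => ∏ j, f j (fun i => x i j)) := by
  unfold prodExp exps
  rw [← (Equiv.piComm (fun (_ : Fin n) (_ : Fin ℓ) => Ω)).sum_comp]
  rfl

end Basics

/-! ### Analytic inequalities -/

lemma exp_cubic (z : ℝ) : 1 + z + z^2/2 - |z|^3 ≤ Real.exp z := by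
  by_cases h : |z| ≤ 1
  · have := Real.exp_bound h (n := 3) (by norm_num)
    rw [abs_le] at this
    have h2 := this.1
    simp [Finset.sum_range_succ, Nat.factorial] at h2
    have : 0 ≤ |z|^3 := by positivity
    nlinarith
  · push Not at h
    have hp := Real.exp_pos z
    rcases le_total 0 z with hz | hz
    · have := Real.quadratic_le_exp_of_nonneg hz
      have : 0 ≤ |z|^3 := by positivity
      linarith
    · rw [abs_of_nonpos hz] at h ⊢
      have : (-z)^2 ≤ (-z)^3 := pow_le_pow_right₀ h.le (by norm_num)
      nlinarith [sq_nonneg z]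

lemma log_lower {δ t : ℝ} (hδ : 0 < δ) (ht : δ ≤ 1 + t) (hδ1 : δ ≤ 1) :
    t - t^2/2 - |t|^3/δ ≤ Real.log (1 + t) := by
  rcases le_total 0 t with h | h
  · have h3 : 0 ≤ |t|^3/δ := by positivity
    have : t - t^2/2 ≤ Real.log (1+t) := by
      have := Real.le_log_one_add_of_nonneg h
      refine le_trans ?_ this
      rw [le_div_iff₀ (by linarith)]
      nlinarith [mul_nonneg h (sq_nonneg t)]
    linarith
  · have h1 : |(-t)| < 1 := by rw [abs_of_nonneg (by linarith)]; linarith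
    have := Real.abs_log_sub_add_sum_range_le h1 2
    rw [abs_le] at this
    have h2 := this.1
    simp [Finset.sum_range_succ] at h2
    have h3 : |t|^3 / (1 - |t|) ≤ |t|^3/δ := by
      apply div_le_div_of_nonneg_left (by positivity) hδ
      rw [abs_of_nonpos h]; linarith
    norm_num at h2
    nlinarith

lemma pow_hyper {η L z : ℝ} (hη : 0 < η) (hη1 : η ≤ 1) (hL : 1/2 ≤ L) (hηL : η * L ≤ 1)
    (hz : 0 ≤ z) (hzL : z ^ 2 ≤ Real.exp L) :
    z ^ (2 + η) ≤ 1 + (1 + η/2) * (z^2 - 1) + 10 * η * L * (z-1)^2 := by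
  rcases le_total z 2 with h2 | h2
  · have e : z ^ (2+η) = z^2 * (z^2) ^ (η/2) := by
      rcases hz.eq_or_lt with h | h
      · subst h; rw [Real.zero_rpow (by linarith)]; simp
      · rw [Real.rpow_add h, ← Real.rpow_natCast z 2, ← Real.rpow_mul hz]
        norm_num
        left
        congr 1
        ring
    have hb : (z^2) ^ (η/2) ≤ 1 + (η/2) * (z^2 - 1) := by
      have := rpow_one_add_le_one_add_mul_self (s := z^2 - 1) (by nlinarith [sq_nonneg z])
        (p := η/2) (by linarith) (by linarith)
      simpa using this
    rw [e]
    have h3 : z^2 * (z^2) ^ (η/2) ≤ z^2 * (1 + (η/2) * (z^2 - 1)) :=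
      mul_le_mul_of_nonneg_left hb (sq_nonneg z)
    have h4 : (z^2-1)^2 ≤ 9 * (z-1)^2 := by
      have : (z^2-1)^2 = (z+1)^2 * (z-1)^2 := by ring
      rw [this]
      apply mul_le_mul_of_nonneg_right _ (sq_nonneg _)
      nlinarith
    have h5 : η * (z-1)^2 * 5 ≤ 10 * η * L * (z-1)^2 := by
      have : 0 ≤ η * (z-1)^2 := by positivity
      nlinarith
    have h6 : (η/2) * (z^2-1)^2 ≤ (η/2) * (9 * (z-1)^2) :=
      mul_le_mul_of_nonneg_left h4 (by linarith)
    have : 0 ≤ η * (z-1)^2 := by positivity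
    nlinarith
  · have hz0 : 0 < z := by linarith
    have hlog : 2 * Real.log z ≤ L := by
      have := Real.log_le_log (by positivity) hzL
      rw [Real.log_exp, Real.log_pow] at this
      exact_mod_cast this
    have hlog0 : 0 ≤ Real.log z := Real.log_nonneg (by linarith)
    have e : z ^ (2+η) = z^2 * Real.exp (η * Real.log z) := by
      rw [Real.rpow_add hz0, Real.rpow_def_of_pos hz0 η, mul_comm η]
      norm_num
    have hθ0 : 0 ≤ η * Real.log z := by positivity
    have hθ : η * Real.log z ≤ 1 := by nlinarith
    have he : Real.exp (η * Real.log z) ≤ 1 + 2 * (η * Real.log z) := by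
      have := Real.exp_bound' hθ0 hθ (n := 2) (by norm_num)
      simp [Finset.sum_range_succ] at this
      nlinarith
    have h3 : z^2 * Real.exp (η * Real.log z) ≤ z^2 * (1 + η * L) := by
      apply mul_le_mul_of_nonneg_left _ (sq_nonneg z)
      nlinarith
    rw [e]
    have h4 : z^2 ≤ 4 * (z-1)^2 := by nlinarith
    have h5 : η * L * z^2 ≤ η * L * (4 * (z-1)^2) :=
      mul_le_mul_of_nonneg_left h4 (by positivity)
    have h6 : 0 ≤ η * L * (z-1)^2 := by positivity
    have h7 : 0 ≤ η/2 * (z^2-1) := by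
      apply mul_nonneg (by linarith); nlinarith
    nlinarith

/-! ### Hypercontractivity -/

section Hyper

variable {Ω : Type} [Fintype Ω]

lemma one_hyper_aux {π : Ω → ℝ} (hπ : ∀ a, 0 < π a) (h1 : ∑ a, π a = 1) {L r η : ℝ}
    (hα : ∀ a, Real.exp (-L) ≤ π a) (hL : 1/2 ≤ L) (hr0 : 0 ≤ r) (hr1 : r ≤ 1) (hη : 0 < η)
    (hη1 : η ≤ 1) (hηL : 20 * η * L ≤ 1 - r^2) (u : Ω → ℝ) (hu : ∑ a, π a * u a ^ 2 = 1)
    (hm : 0 ≤ ∑ a, π a * u a) :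
    ∑ a, π a * |r * u a + (1 - r) * ∑ b, π b * u b| ^ (2 + η) ≤ 1 := by
  set m := ∑ a, π a * u a with hmdef
  have hm1 : m ^ 2 ≤ 1 := by rw [← hu]; exact wjensen (fun a => (hπ a).le) h1 u
  have hbd : ∀ a, u a ^ 2 ≤ Real.exp L := by
    intro a
    have h2 : π a * u a ^ 2 ≤ 1 := by
      rw [← hu]
      exact Finset.single_le_sum (f := fun a => π a * u a ^ 2)
        (fun b _ => mul_nonneg (hπ b).le (sq_nonneg _)) (Finset.mem_univ a)
    have h3 : Real.exp (-L) * u a ^ 2 ≤ 1 :=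
      le_trans (mul_le_mul_of_nonneg_right (hα a) (sq_nonneg _)) h2
    have h4 : Real.exp L * Real.exp (-L) = 1 := by rw [← Real.exp_add]; simp
    have h5 := mul_le_mul_of_nonneg_left h3 (Real.exp_pos L).le
    rw [← mul_assoc, h4] at h5
    linarith
  have hE1 : 1 ≤ Real.exp L := Real.one_le_exp (by linarith)
  set g : Ω → ℝ := fun a => r * u a + (1 - r) * m with hg
  have hgb : ∀ a, |g a| ^ 2 ≤ Real.exp L := by
    intro a
    rw [sq_abs]
    have h2 : g a ^ 2 ≤ r * u a ^ 2 + (1 - r) * m ^ 2 := by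
      have : r * u a ^ 2 + (1 - r) * m ^ 2 - g a ^ 2 = r * (1 - r) * (u a - m) ^ 2 := by
        simp only [hg]; ring
      have h3 : 0 ≤ r * (1 - r) * (u a - m) ^ 2 :=
        mul_nonneg (mul_nonneg hr0 (by linarith)) (sq_nonneg _)
      linarith
    have := hbd a
    nlinarith
  have hpt : ∀ a, |g a| ^ (2 + η) ≤ 1 + (1 + η/2) * (g a ^ 2 - 1) + 10 * η * L * (g a - 1)^2 := by
    intro a
    have h2 := pow_hyper hη hη1 hL (by nlinarith [sq_nonneg r]) (abs_nonneg (g a)) (hgb a)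
    rw [sq_abs] at h2
    have h3 : (|g a| - 1)^2 ≤ (g a - 1)^2 := by
      have := le_abs_self (g a)
      have h4 := sq_abs (g a)
      nlinarith
    have h5 : 10 * η * L * (|g a| - 1)^2 ≤ 10 * η * L * (g a - 1)^2 :=
      mul_le_mul_of_nonneg_left h3 (by positivity)
    linarith
  have hsum : ∑ a, π a * |g a| ^ (2 + η) ≤
      ∑ a, π a * (1 + (1 + η/2) * (g a ^ 2 - 1) + 10 * η * L * (g a - 1)^2) :=
    Finset.sum_le_sum fun a _ => mul_le_mul_of_nonneg_left (hpt a) (hπ a).le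
  refine hsum.trans ?_
  have hval : ∑ a, π a * (1 + (1 + η/2) * (g a ^ 2 - 1) + 10 * η * L * (g a - 1)^2)
      = (1 + (1 + η/2) * ((r^2 + (1 - r^2) * m^2) - 1)
        + 10 * η * L * ((r^2 + (1 - r^2) * m^2) - 2 * m + 1)) := by
    have e : ∀ a, π a * (1 + (1 + η/2) * (g a ^ 2 - 1) + 10 * η * L * (g a - 1)^2)
        = (((1 + η/2) + 10 * η * L) * r^2) * (π a * u a ^ 2)
        + (((1 + η/2) + 10 * η * L) * (2 * r * (1 - r) * m) - 2 * (10 * η * L) * r) * (π a * u a)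
        + (((1 + η/2) + 10 * η * L) * ((1 - r) * m)^2 - 2 * (10 * η * L) * (1 - r) * m + 1
          - (1 + η/2) + 10 * η * L) * π a := by
      intro a
      simp only [hg]
      ring
    simp only [e, Finset.sum_add_distrib, ← Finset.mul_sum]
    rw [hu, h1, ← hmdef]
    ring
  rw [hval]
  have hm1' : m ≤ 1 := by nlinarith
  have hr2 : 0 ≤ 1 - r^2 := by nlinarith
  have k1 : (r^2 + (1 - r^2) * m^2) - 2 * m + 1 ≤ 2 * (1 - m^2) := by nlinarith
  have k2 : 10 * η * L * ((r^2 + (1 - r^2) * m^2) - 2 * m + 1) ≤ 10 * η * L * (2 * (1 - m^2)) :=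
    mul_le_mul_of_nonneg_left k1 (by positivity)
  have k3 : 20 * η * L * (1 - m^2) ≤ (1 - r^2) * (1 - m^2) :=
    mul_le_mul_of_nonneg_right hηL (by linarith)
  have k4 : 0 ≤ η/2 * ((1 - r^2) * (1 - m^2)) := by
    apply mul_nonneg (by linarith); apply mul_nonneg hr2; linarith
  nlinarith

lemma one_hyper {π : Ω → ℝ} (hπ : ∀ a, 0 < π a) (h1 : ∑ a, π a = 1) {L r η : ℝ}
    (hα : ∀ a, Real.exp (-L) ≤ π a) (hL : 1/2 ≤ L) (hr0 : 0 ≤ r) (hr1 : r ≤ 1) (hη : 0 < η)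
    (hη1 : η ≤ 1) (hηL : 20 * η * L ≤ 1 - r^2) (u : Ω → ℝ) :
    ∑ a, π a * |r * u a + (1 - r) * ∑ b, π b * u b| ^ (2 + η) ≤
      (∑ a, π a * u a ^ 2) ^ (1 + η/2) := by
  have hN0 : 0 ≤ ∑ a, π a * u a ^ 2 :=
    Finset.sum_nonneg fun b _ => mul_nonneg (hπ b).le (sq_nonneg _)
  rcases hN0.eq_or_lt with h | h
  · have hz : ∀ a, u a = 0 := by
      intro a
      have := (Finset.sum_eq_zero_iff_of_nonneg
        (fun b _ => mul_nonneg (hπ b).le (sq_nonneg (u b)))).1 h.symm a (Finset.mem_univ a)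
      have h3 := (mul_eq_zero.1 this).resolve_left (hπ a).ne'
      exact pow_eq_zero_iff (by norm_num) |>.1 h3
    simp [hz]
    rw [Real.zero_rpow (by linarith), Real.zero_rpow (by linarith)]
    simp
  · set S := ∑ a, π a * u a ^ 2 with hS
    -- normalising factor with sign
    obtain ⟨c, hc, hcm⟩ : ∃ c : ℝ, c ^ 2 = S ∧ 0 ≤ c⁻¹ * ∑ a, π a * u a := by
      rcases le_total 0 (∑ a, π a * u a) with hm | hm
      · exact ⟨√S, Real.sq_sqrt h.le, mul_nonneg (inv_nonneg.2 (Real.sqrt_nonneg _)) hm⟩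
      · refine ⟨-√S, by rw [neg_sq]; exact Real.sq_sqrt h.le, ?_⟩
        rw [inv_neg]
        have := inv_nonneg.2 (Real.sqrt_nonneg S)
        nlinarith
    have hc0 : c ≠ 0 := by rintro rfl; norm_num at hc; linarith
    have e1 : ∑ a, π a * (c⁻¹ * u a) = c⁻¹ * ∑ a, π a * u a := by
      rw [Finset.mul_sum]; exact Finset.sum_congr rfl fun a _ => by ring
    have e2 : ∑ a, π a * (c⁻¹ * u a)^2 = 1 := by
      have : ∑ a, π a * (c⁻¹ * u a)^2 = (c⁻¹)^2 * S := by
        rw [hS, Finset.mul_sum]; exact Finset.sum_congr rfl fun a _ => by ring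
      rw [this, ← hc]; field_simp
    have := one_hyper_aux hπ h1 hα hL hr0 hr1 hη hη1 hηL (fun a => c⁻¹ * u a) e2
      (by rw [e1]; exact hcm)
    rw [e1] at this
    have hcS : |c| ^ (2 + η) = S ^ (1 + η/2) := by
      rw [← hc, ← sq_abs, ← Real.rpow_natCast |c| 2, ← Real.rpow_mul (abs_nonneg c)]
      congr 1
      push_cast; ring
    have e3 : ∀ a, |r * u a + (1 - r) * ∑ b, π b * u b| ^ (2 + η)
        = |c| ^ (2 + η) * |r * (c⁻¹ * u a) + (1 - r) * (c⁻¹ * ∑ b, π b * u b)| ^ (2 + η) := by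
      intro a
      rw [← Real.mul_rpow (abs_nonneg _) (abs_nonneg _), ← abs_mul]
      congr 2
      field_simp
    calc ∑ a, π a * |r * u a + (1 - r) * ∑ b, π b * u b| ^ (2 + η)
        = |c| ^ (2 + η) * ∑ a, π a *
          |r * (c⁻¹ * u a) + (1 - r) * (c⁻¹ * ∑ b, π b * u b)| ^ (2 + η) := by
          refine Eq.trans (Finset.sum_congr rfl fun a _ => ?_) (Finset.mul_sum _ _ _).symm
          rw [e3]; ring
      _ ≤ |c| ^ (2 + η) * 1 := mul_le_mul_of_nonneg_left this (by positivity)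
      _ = _ := by rw [mul_one, hcS]

lemma minkowski {V A : Type} [Fintype V] [Fintype A] {w : V → ℝ} (hw : ∀ v, 0 < w v)
    {c : A → ℝ} (hc : ∀ a, 0 < c a) {p : ℝ} (hp : 1 ≤ p) (G : A → V → ℝ)
    (hG : ∀ a v, 0 ≤ G a v) (M : A → ℝ) (hM : ∀ a, 0 ≤ M a)
    (h : ∀ a, ∑ v, w v * G a v ^ p ≤ M a ^ p) :
    ∑ v, w v * (∑ a, c a * G a v) ^ p ≤ (∑ a, c a * M a) ^ p := by
  have hz : ∀ a v, M a = 0 → G a v = 0 := by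
    intro a v h0
    have h2 := h a
    rw [h0, Real.zero_rpow (by linarith)] at h2
    have h3 : w v * G a v ^ p ≤ 0 := le_trans
      (Finset.single_le_sum (f := fun v => w v * G a v ^ p)
        (fun v _ => mul_nonneg (hw v).le (Real.rpow_nonneg (hG a v) _)) (Finset.mem_univ v)) h2
    have h4 : G a v ^ p ≤ 0 := by
      by_contra hh
      push Not at hh
      have := mul_pos (hw v) hh
      linarith
    have h5 : G a v ^ p = 0 := le_antisymm h4 (Real.rpow_nonneg (hG a v) _)
    exact ((Real.rpow_eq_zero (hG a v) (by linarith)).1 h5)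
  set S := ∑ a, c a * M a with hS
  have hS0 : 0 ≤ S := Finset.sum_nonneg fun a _ => mul_nonneg (hc a).le (hM a)
  rcases hS0.eq_or_lt with h0 | h0
  · have hMz : ∀ a, M a = 0 := by
      intro a
      have := (Finset.sum_eq_zero_iff_of_nonneg
        (fun a _ => mul_nonneg (hc a).le (hM a))).1 h0.symm a (Finset.mem_univ a)
      exact (mul_eq_zero.1 this).resolve_left (hc a).ne'
    have : ∀ a v, G a v = 0 := fun a v => hz a v (hMz a)
    simp [this, ← h0]
    rw [Real.zero_rpow (by linarith)]; simp
  · have hpt : ∀ v, (∑ a, c a * G a v) ^ p ≤ S ^ p * ∑ a, (c a * M a / S) * (G a v / M a) ^ p := by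
      intro v
      have e : ∑ a, c a * G a v = S * ∑ a, (c a * M a / S) * (G a v / M a) := by
        rw [Finset.mul_sum]
        refine Finset.sum_congr rfl fun a _ => ?_
        by_cases hm : M a = 0
        · rw [hz a v hm, hm]; simp
        · field_simp
      have hnn : 0 ≤ ∑ a, (c a * M a / S) * (G a v / M a) := Finset.sum_nonneg fun a _ => mul_nonneg
        (div_nonneg (mul_nonneg (hc a).le (hM a)) hS0) (div_nonneg (hG a v) (hM a))
      rw [e, Real.mul_rpow hS0 hnn]
      apply mul_le_mul_of_nonneg_left _ (Real.rpow_nonneg hS0 _)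
      apply Real.rpow_arith_mean_le_arith_mean_rpow _ _ _ _ _ _ hp
      · exact fun a _ => div_nonneg (mul_nonneg (hc a).le (hM a)) hS0
      · rw [← Finset.sum_div, ← hS]; exact div_self h0.ne'
      · exact fun a _ => div_nonneg (hG a v) (hM a)
    calc _ ≤ ∑ v, w v * (S ^ p * ∑ a, (c a * M a / S) * (G a v / M a) ^ p) :=
          Finset.sum_le_sum fun v _ => mul_le_mul_of_nonneg_left (hpt v) (hw v).le
      _ = S ^ p * ∑ a, (c a * M a / S) * ∑ v, w v * (G a v / M a) ^ p := by
          simp only [Finset.mul_sum]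
          rw [Finset.sum_comm]
          exact Finset.sum_congr rfl fun a _ => Finset.sum_congr rfl fun v _ => by ring
      _ ≤ S ^ p * ∑ a, (c a * M a / S) * 1 := by
          apply mul_le_mul_of_nonneg_left _ (Real.rpow_nonneg hS0 _)
          refine Finset.sum_le_sum fun a _ => ?_
          apply mul_le_mul_of_nonneg_left _ (div_nonneg (mul_nonneg (hc a).le (hM a)) hS0)
          rcases (hM a).eq_or_lt with hm | hm
          · simp [← hm, Real.zero_rpow (show p ≠ 0 by linarith)]
          · have : ∀ v, w v * (G a v / M a) ^ p = (w v * G a v ^ p) / M a ^ p := by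
              intro v
              rw [Real.div_rpow (hG a v) (hM a)]; ring
            simp only [this, ← Finset.sum_div]
            exact (div_le_one (Real.rpow_pos_of_pos hm _)).2 (h a)
      _ = S ^ p := by
          simp only [mul_one]
          rw [← Finset.sum_div, ← hS, div_self h0.ne', mul_one]

/-! ### Product kernels -/

/-- The `n`-fold tensor power of the kernel `κ`, acting on functions. -/
noncomputable def ker {Y A : Type} [Fintype A] (κ : Y → A → ℝ) :
    (n : ℕ) → ((Fin n → A) → ℝ) → (Fin n → Y) → ℝ
  | 0, h, _ => h (fun i => i.elim0)
  | n+1, h, x => ∑ a, κ (x 0) a * ker κ n (fun v => h (Fin.cons a v)) (Fin.tail x)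

lemma ker_cons {Y A : Type} [Fintype A] (κ : Y → A → ℝ) {n : ℕ} (h : (Fin (n+1) → A) → ℝ)
    (y : Y) (x : Fin n → Y) :
    ker κ (n+1) h (Fin.cons y x) = ∑ a, κ y a * ker κ n (fun v => h (Fin.cons a v)) x := by
  simp [ker]

lemma ker_wsum {Y A B : Type} [Fintype A] [Fintype B] (κ : Y → A → ℝ) {n : ℕ} (c : B → ℝ)
    (h : B → (Fin n → A) → ℝ) (x : Fin n → Y) :
    ker κ n (fun v => ∑ b, c b * h b v) x = ∑ b, c b * ker κ n (h b) x := by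
  induction n with
  | zero => rfl
  | succ n ih =>
    simp only [ker]
    simp only [ih (fun b v => h b (Fin.cons _ v)), Finset.mul_sum]
    rw [Finset.sum_comm]
    exact Finset.sum_congr rfl fun b _ => Finset.sum_congr rfl fun a _ => by ring

lemma ker_sub {Y A : Type} [Fintype A] (κ : Y → A → ℝ) {n : ℕ}
    (h g : (Fin n → A) → ℝ) (x : Fin n → Y) :
    ker κ n (fun v => h v - g v) x = ker κ n h x - ker κ n g x := by
  induction n with
  | zero => rfl
  | succ n ih =>
    simp only [ker]
    simp only [ih (fun v => h (Fin.cons _ v)) (fun v => g (Fin.cons _ v)), mul_sub,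
      Finset.sum_sub_distrib]

lemma ker_comp {Y A B : Type} [Fintype A] [Fintype B] (κ : Y → A → ℝ) (κ' : A → B → ℝ)
    (κ'' : Y → B → ℝ) (hκ : ∀ y b, ∑ a, κ y a * κ' a b = κ'' y b) {n : ℕ}
    (h : (Fin n → B) → ℝ) (x : Fin n → Y) :
    ker κ n (ker κ' n h) x = ker κ'' n h x := by
  induction n with
  | zero => rfl
  | succ n ih =>
    simp only [ker]
    simp only [Fin.cons_zero, Fin.tail_cons]
    simp only [ker_wsum, ih, ← hκ, Finset.mul_sum, Finset.sum_mul]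
    rw [Finset.sum_comm]
    exact Finset.sum_congr rfl fun b _ => Finset.sum_congr rfl fun a _ => by ring

open Classical in
/-- The noise kernel. -/
noncomputable def nk (π : Ω → ℝ) (r : ℝ) (b a : Ω) : ℝ := r * (if a = b then 1 else 0) + (1 - r) * π a

lemma nk_sum (π : Ω → ℝ) (r : ℝ) (b : Ω) (u : Ω → ℝ) :
    ∑ a, nk π r b a * u a = r * u b + (1 - r) * ∑ a, π a * u a := by
  classical
  simp only [nk, add_mul, Finset.sum_add_distrib, Finset.mul_sum]
  congr 1
  · simp
  · exact Finset.sum_congr rfl fun b _ => by ring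

lemma nk_comp {π : Ω → ℝ} (h1 : ∑ a, π a = 1) (r s : ℝ) (y b : Ω) :
    ∑ a, nk π r y a * nk π s a b = nk π (r * s) y b := by
  classical
  rw [nk_sum]
  simp only [nk, mul_add, Finset.sum_add_distrib]
  have : ∑ x, π x * ((1 - s) * π b) = (1 - s) * π b := by rw [← Finset.sum_mul, h1, one_mul]
  rw [this]
  have : ∑ x, π x * (s * if b = x then 1 else 0) = π b * s := by
    simp
  rw [this]
  ring

/-- The noise operator `T_r`. -/
noncomputable def T (π : Ω → ℝ) (r : ℝ) {n : ℕ} (f : (Fin n → Ω) → ℝ) : (Fin n → Ω) → ℝ :=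
  ker (nk π r) n f

lemma T_cons (π : Ω → ℝ) (r : ℝ) {n : ℕ} (f : (Fin (n+1) → Ω) → ℝ) (a : Ω) (v : Fin n → Ω) :
    T π r f (Fin.cons a v) = r * T π r (fun v => f (Fin.cons a v)) v
      + (1 - r) * ∑ b, π b * T π r (fun v => f (Fin.cons b v)) v := by
  unfold T
  rw [ker_cons, nk_sum]

lemma T_comp {π : Ω → ℝ} (h1 : ∑ a, π a = 1) (r s : ℝ) {n : ℕ} (f : (Fin n → Ω) → ℝ)
    (v : Fin n → Ω) : T π r (T π s f) v = T π (r * s) f v :=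
  ker_comp _ _ _ (nk_comp h1 r s) f v

lemma T_wsum {B : Type} [Fintype B] (π : Ω → ℝ) (r : ℝ) {n : ℕ} (c : B → ℝ)
    (h : B → (Fin n → Ω) → ℝ) (x : Fin n → Ω) :
    T π r (fun v => ∑ b, c b * h b v) x = ∑ b, c b * T π r (h b) x := ker_wsum _ _ _ _

lemma T_sub (π : Ω → ℝ) (r : ℝ) {n : ℕ} (h g : (Fin n → Ω) → ℝ) (x : Fin n → Ω) :
    T π r (fun v => h v - g v) x = T π r h x - T π r g x := ker_sub _ _ _ _

lemma T_bounds {π : Ω → ℝ} (hπ : ∀ a, 0 ≤ π a) (h1 : ∑ a, π a = 1) {r : ℝ} (hr0 : 0 ≤ r)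
    (hr1 : r ≤ 1) {lo hi : ℝ} {n : ℕ} (f : (Fin n → Ω) → ℝ) (hf : ∀ v, f v ∈ Set.Icc lo hi)
    (v : Fin n → Ω) : T π r f v ∈ Set.Icc lo hi := by
  induction n with
  | zero => exact hf _
  | succ n ih =>
    rw [← Fin.cons_self_tail v, T_cons]
    have hb : ∀ b, T π r (fun v => f (Fin.cons b v)) (Fin.tail v) ∈ Set.Icc lo hi :=
      fun b => ih _ (fun v => hf _) _
    have hlo : lo ≤ ∑ b, π b * T π r (fun v => f (Fin.cons b v)) (Fin.tail v) := by
      calc lo = ∑ b, π b * lo := by rw [← Finset.sum_mul, h1, one_mul]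
        _ ≤ _ := Finset.sum_le_sum fun b _ => mul_le_mul_of_nonneg_left (hb b).1 (hπ b)
    have hhi : ∑ b, π b * T π r (fun v => f (Fin.cons b v)) (Fin.tail v) ≤ hi := by
      calc _ ≤ ∑ b, π b * hi :=
            Finset.sum_le_sum fun b _ => mul_le_mul_of_nonneg_left (hb b).2 (hπ b)
        _ = hi := by rw [← Finset.sum_mul, h1, one_mul]
    have h0 := hb (v 0)
    constructor
    · nlinarith [h0.1]
    · nlinarith [h0.2]

lemma exps_T {π : Ω → ℝ} (h1 : ∑ a, π a = 1) (r : ℝ) {n : ℕ} (f : (Fin n → Ω) → ℝ) :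
    exps π (T π r f) = exps π f := by
  induction n with
  | zero =>
    rw [exps_zero _ _ (fun i => i.elim0), exps_zero _ _ (fun i => i.elim0)]; rfl
  | succ n ih =>
    rw [exps_succ, exps_succ]
    simp only [T_cons, exps_add, exps_smul, exps_wsum, ih, mul_add, Finset.sum_add_distrib]
    rw [← Finset.sum_mul, h1]
    simp only [Finset.mul_sum, one_mul, ← Finset.sum_add_distrib]
    exact Finset.sum_congr rfl fun b _ => by ring

/-- `(2, 2+η)`-hypercontractivity. -/
lemma hyper {π : Ω → ℝ} (hπ : ∀ a, 0 < π a) (h1 : ∑ a, π a = 1) {L r η : ℝ}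
    (hα : ∀ a, Real.exp (-L) ≤ π a) (hL : 1/2 ≤ L) (hr0 : 0 ≤ r) (hr1 : r ≤ 1) (hη : 0 < η)
    (hη1 : η ≤ 1) (hηL : 20 * η * L ≤ 1 - r^2) {n : ℕ} (h : (Fin n → Ω) → ℝ) :
    exps π (fun v => |T π r h v| ^ (2 + η)) ≤ (exps π (fun v => h v ^ 2)) ^ (1 + η/2) := by
  have hab : ∀ x : ℝ, |x| ^ (2 + η) = (x ^ 2) ^ (1 + η/2) := by
    intro x
    rw [← sq_abs x, ← Real.rpow_natCast |x| 2, ← Real.rpow_mul (abs_nonneg x)]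
    congr 1
    push_cast; ring
  induction n with
  | zero =>
    rw [exps_zero _ _ (fun i => i.elim0), exps_zero _ _ (fun i => i.elim0), ← hab]
    rfl
  | succ n ih =>
    rw [exps_succ, exps_succ, ← exps_wsum]
    calc _ ≤ exps π (fun v : Fin n → Ω =>
          (∑ a, π a * (T π r (fun v => h (Fin.cons a v)) v) ^ 2) ^ (1 + η/2)) := by
          apply exps_mono (fun a => (hπ a).le)
          intro v
          simp only [T_cons]
          exact one_hyper hπ h1 hα hL hr0 hr1 hη hη1 hηL
            (fun a => T π r (fun v => h (Fin.cons a v)) v)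
      _ ≤ _ := by
          refine minkowski (w := fun v : Fin n → Ω => ∏ i, π (v i))
            (fun v => Finset.prod_pos fun i _ => hπ _) hπ (by linarith)
            (fun a v => (T π r (fun v => h (Fin.cons a v)) v) ^ 2) (fun a v => sq_nonneg _)
            (fun a => exps π (fun v => h (Fin.cons a v) ^ 2))
            (fun a => exps_nonneg (fun a => (hπ a).le) fun v => sq_nonneg _) ?_
          intro a
          have := ih (fun v => h (Fin.cons a v))
          simp only [hab] at this
          exact this

end Hyper

/-! ### Martingale error functional -/

section Mart

variable {Ω : Type} [Fintype Ω]

/-- average out the first coordinate -/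
noncomputable def avg (π : Ω → ℝ) {n : ℕ} (f : (Fin (n+1) → Ω) → ℝ) : (Fin n → Ω) → ℝ :=
  fun v => ∑ a, π a * f (Fin.cons a v)

/-- sum of the `q`-th moments of the martingale increments -/
noncomputable def Err (π : Ω → ℝ) (q : ℝ) : (n : ℕ) → ((Fin n → Ω) → ℝ) → ℝ
  | 0, _ => 0
  | n+1, g => (∑ a, π a * exps π (fun v => |g (Fin.cons a v) - avg π g v| ^ q))
      + Err π q n (avg π g)

lemma exps_avg (π : Ω → ℝ) {n : ℕ} (f : (Fin (n+1) → Ω) → ℝ) :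
    exps π (avg π f) = exps π f := by
  rw [exps_succ]; exact exps_wsum _ _ _

lemma avg_bounds {π : Ω → ℝ} (hπ : ∀ a, 0 ≤ π a) (h1 : ∑ a, π a = 1) {lo hi : ℝ} {n : ℕ}
    (f : (Fin (n+1) → Ω) → ℝ) (hf : ∀ v, f v ∈ Set.Icc lo hi)
    (v : Fin n → Ω) : avg π f v ∈ Set.Icc lo hi := by
  constructor
  · calc lo = ∑ b, π b * lo := by rw [← Finset.sum_mul, h1, one_mul]
      _ ≤ _ := Finset.sum_le_sum fun b _ => mul_le_mul_of_nonneg_left (hf _).1 (hπ b)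
  · calc _ ≤ ∑ b, π b * hi :=
          Finset.sum_le_sum fun b _ => mul_le_mul_of_nonneg_left (hf _).2 (hπ b)
      _ = hi := by rw [← Finset.sum_mul, h1, one_mul]

lemma T_avg {π : Ω → ℝ} (h1 : ∑ a, π a = 1) (r : ℝ) {n : ℕ} (f : (Fin (n+1) → Ω) → ℝ) :
    avg π (T π r f) = T π r (avg π f) := by
  funext v
  have : T π r (avg π f) v = ∑ a, π a * T π r (fun v => f (Fin.cons a v)) v := T_wsum _ _ _ _ _
  rw [this]
  simp only [avg, T_cons, mul_add, Finset.sum_add_distrib]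
  rw [← Finset.sum_mul, h1, one_mul]
  have : ∑ x, π x * (r * T π r (fun v => f (Fin.cons x v)) v)
      = r * ∑ x, π x * T π r (fun v => f (Fin.cons x v)) v := by
    rw [Finset.mul_sum]; exact Finset.sum_congr rfl fun b _ => by ring
  rw [this]
  ring

lemma T_decomp {π : Ω → ℝ} (r : ℝ) {n : ℕ} (f : (Fin (n+1) → Ω) → ℝ)
    (a : Ω) (v : Fin n → Ω) :
    T π r f (Fin.cons a v) = T π r (avg π f) v
      + r * T π r (fun v => f (Fin.cons a v) - avg π f v) v := by
  have : T π r (avg π f) v = ∑ a, π a * T π r (fun v => f (Fin.cons a v)) v := T_wsum _ _ _ _ _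
  rw [T_cons, T_sub, this]
  ring

lemma D_sum {π : Ω → ℝ} (h1 : ∑ a, π a = 1) (r : ℝ) {n : ℕ} (f : (Fin (n+1) → Ω) → ℝ)
    (v : Fin n → Ω) :
    ∑ a, π a * T π r (fun v => f (Fin.cons a v) - avg π f v) v = 0 := by
  have : T π r (avg π f) v = ∑ a, π a * T π r (fun v => f (Fin.cons a v)) v := T_wsum _ _ _ _ _
  simp only [T_sub, mul_sub, Finset.sum_sub_distrib]
  rw [← Finset.sum_mul, h1, this]
  ring

lemma influence_zero {π : Ω → ℝ} (h1 : ∑ a, π a = 1) {n : ℕ} (f : (Fin (n+1) → Ω) → ℝ) :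
    influence π 0 f = ∑ a, π a * exps π (fun v => (f (Fin.cons a v) - avg π f v) ^ 2) := by
  have : influence π 0 f = exps π (fun v => varPi π (fun a => f (Function.update v 0 a))) := rfl
  rw [this, exps_succ]
  simp only [Fin.update_cons_zero]
  rw [← Finset.sum_mul, h1, one_mul, ← exps_wsum]
  rfl

lemma influence_nonneg {π : Ω → ℝ} (hπ : ∀ a, 0 ≤ π a) {n : ℕ} (i : Fin n)
    (f : (Fin n → Ω) → ℝ) : 0 ≤ influence π i f :=
  exps_nonneg hπ fun v => Finset.sum_nonneg fun a _ => mul_nonneg (hπ a) (sq_nonneg _)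

lemma influence_avg {π : Ω → ℝ} (hπ : ∀ a, 0 ≤ π a) (h1 : ∑ a, π a = 1) {n : ℕ}
    (f : (Fin (n+1) → Ω) → ℝ) (i : Fin n) :
    influence π i (avg π f) ≤ influence π i.succ f := by
  have e1 : influence π i.succ f
      = exps π (fun v => varPi π (fun a => f (Function.update v i.succ a))) := rfl
  have e2 : influence π i (avg π f)
      = exps π (fun v => varPi π (fun a => avg π f (Function.update v i a))) := rfl
  rw [e1, e2, exps_succ, ← exps_wsum]
  apply exps_mono hπ
  intro v
  simp only [← Fin.cons_update]
  -- convexity of the variance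
  simp only [varPi, expPi, avg]
  have e3 : ∑ b, π b * ∑ a, π a * (f (Fin.cons b (Function.update v i a))
      - ∑ a, π a * f (Fin.cons b (Function.update v i a))) ^ 2
      = ∑ a, π a * ∑ b, π b * (f (Fin.cons b (Function.update v i a))
      - ∑ a, π a * f (Fin.cons b (Function.update v i a))) ^ 2 := by
    simp only [Finset.mul_sum]
    rw [Finset.sum_comm]
    exact Finset.sum_congr rfl fun b _ => Finset.sum_congr rfl fun a _ => by ring
  rw [e3]
  refine Finset.sum_le_sum fun a _ => mul_le_mul_of_nonneg_left ?_ (hπ a)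
  have := wjensen hπ h1 (fun b => f (Fin.cons b (Function.update v i a))
      - ∑ a, π a * f (Fin.cons b (Function.update v i a)))
  refine le_trans (le_of_eq ?_) this
  congr 1
  simp only [mul_sub, Finset.sum_sub_distrib]
  congr 1
  simp only [Finset.mul_sum]
  rw [Finset.sum_comm]
  exact Finset.sum_congr rfl fun b _ => Finset.sum_congr rfl fun a _ => by ring

lemma exps_sq_decomp {π : Ω → ℝ} (h1 : ∑ a, π a = 1) {n : ℕ} (f : (Fin (n+1) → Ω) → ℝ) :
    exps π (fun v => f v ^ 2) = exps π (fun v => avg π f v ^ 2)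
      + ∑ a, π a * exps π (fun v => (f (Fin.cons a v) - avg π f v) ^ 2) := by
  rw [exps_succ, ← exps_wsum, ← exps_wsum, ← exps_add]
  congr 1
  funext v
  have e : ∀ a, π a * (f (Fin.cons a v) - avg π f v) ^ 2
      = π a * f (Fin.cons a v) ^ 2 - 2 * avg π f v * (π a * f (Fin.cons a v))
        + avg π f v ^ 2 * π a := fun a => by ring
  simp only [e, Finset.sum_add_distrib, Finset.sum_sub_distrib, ← Finset.mul_sum, h1]
  have : ∑ a, π a * f (Fin.cons a v) = avg π f v := rfl
  rw [this]
  ring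

lemma err_bound {π : Ω → ℝ} (hπ : ∀ a, 0 < π a) (h1 : ∑ a, π a = 1) {L r η τ : ℝ}
    (hα : ∀ a, Real.exp (-L) ≤ π a) (hL : 1/2 ≤ L) (hr0 : 0 ≤ r) (hr1 : r ≤ 1) (hη : 0 < η)
    (hη1 : η ≤ 1) (hηL : 20 * η * L ≤ 1 - r^2) {n : ℕ} (f : (Fin n → Ω) → ℝ)
    (hinf : ∀ i, influence π i f ≤ τ) :
    Err π (2 + η) n (T π r f) ≤ τ ^ (η/2) * exps π (fun v => f v ^ 2) := by
  have hπ' := fun a => (hπ a).le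
  induction n with
  | zero =>
    simp only [Err]
    rw [exps_zero _ _ (fun i => i.elim0)]
    rcases le_or_gt 0 τ with h | h
    · positivity
    · exact mul_nonneg (by
        rw [Real.rpow_def_of_neg h]
        apply mul_nonneg (Real.exp_pos _).le
        apply Real.cos_nonneg_of_neg_pi_div_two_le_of_le <;> nlinarith [Real.pi_pos])
        (sq_nonneg _)
  | succ n ih =>
    simp only [Err]
    rw [T_avg h1, exps_sq_decomp h1, mul_add, add_comm]
    have hI := influence_zero h1 f
    set I := ∑ a, π a * exps π (fun v => (f (Fin.cons a v) - avg π f v) ^ 2) with hIdef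
    have hI0 : 0 ≤ I := by rw [← hI]; exact influence_nonneg hπ' _ _
    have hIτ : I ≤ τ := by rw [← hI]; exact hinf 0
    refine add_le_add (ih _ fun i => (influence_avg hπ' h1 f i).trans (hinf _)) ?_
    set h : (Fin (n+1) → Ω) → ℝ := fun x => f x - avg π f (Fin.tail x) with hh
    have hcons : ∀ a v, h (Fin.cons a v) = f (Fin.cons a v) - avg π f v := by
      intro a v; simp [hh]
    have havg : ∀ v, ∑ b, π b * T π r (fun v => h (Fin.cons b v)) v = 0 := by
      intro v
      simp only [hcons]
      exact D_sum h1 r f v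
    have hTh : ∀ a v, T π r h (Fin.cons a v) = T π r f (Fin.cons a v) - T π r (avg π f) v := by
      intro a v
      rw [T_cons, havg, T_decomp]
      simp only [hcons]
      ring
    have key := hyper hπ h1 hα hL hr0 hr1 hη hη1 hηL h
    rw [exps_succ, exps_succ] at key
    simp only [hTh, hcons] at key
    rw [← hIdef] at key
    refine key.trans ?_
    rcases hI0.eq_or_lt with h0 | h0
    · rw [← h0, Real.zero_rpow (by linarith)]; simp
    · rw [Real.rpow_add h0, Real.rpow_one, mul_comm]
      apply mul_le_mul_of_nonneg_right _ hI0
      exact Real.rpow_le_rpow hI0 hIτ (by linarith)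

/-! ### Spectral estimate for the noise operator -/

lemma spec {π : Ω → ℝ} (hπ : ∀ a, 0 ≤ π a) (h1 : ∑ a, π a = 1) {n : ℕ}
    (f : (Fin n → Ω) → ℝ) :
    ∃ w : ℕ → ℝ, (∀ k, 0 ≤ w k) ∧ (∀ k, n < k → w k = 0) ∧
      ∀ r s : ℝ, exps π (fun v => T π r f v * T π s f v)
        = ∑ k ∈ Finset.range (n+1), (r * s) ^ k * w k := by
  induction n with
  | zero =>
    refine ⟨fun k => if k = 0 then (f (fun i => i.elim0))^2 else 0, ?_, ?_, ?_⟩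
    · intro k; dsimp only; split_ifs
      · positivity
      · exact le_rfl
    · intro k hk; simp [hk.ne']
    · intro r s
      rw [exps_zero _ _ (fun i => i.elim0)]
      simp [T, ker, sq]
  | succ n ih =>
    obtain ⟨w0, hw0, hz0, he0⟩ := ih (avg π f)
    choose w hw hz he using fun a => ih (fun v => f (Fin.cons a v) - avg π f v)
    refine ⟨fun k => w0 k + (match k with | 0 => 0 | k+1 => ∑ a, π a * w a k), ?_, ?_, ?_⟩
    · rintro (_ | k)
      · simpa using hw0 0
      · exact add_nonneg (hw0 _) (Finset.sum_nonneg fun a _ => mul_nonneg (hπ a) (hw a k))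
    · rintro (_ | k) hk
      · omega
      · simp only []
        rw [hz0 _ (by omega), Finset.sum_eq_zero fun a _ => by rw [hz a k (by omega), mul_zero],
          add_zero]
    · intro r s
      simp only [mul_add, Finset.sum_add_distrib]
      rw [Finset.sum_range_succ, hz0 (n+1) (by omega), mul_zero, add_zero, ← he0,
        Finset.sum_range_succ' _ (n+1)]
      simp only [mul_zero, add_zero]
      have e : ∑ k ∈ Finset.range (n+1), (r * s) ^ (k+1) * ∑ a, π a * w a k
          = ∑ a, π a * (r * s * ∑ k ∈ Finset.range (n+1), (r * s)^k * w a k) := by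
        simp only [Finset.mul_sum]
        rw [Finset.sum_comm]
        exact Finset.sum_congr rfl fun a _ => Finset.sum_congr rfl fun k _ => by ring
      rw [e]
      simp only [← he, ← exps_smul]
      rw [← exps_sum, ← exps_add, exps_succ, ← exps_wsum]
      congr 1
      funext v
      have hr := D_sum h1 r f v
      have hs := D_sum h1 s f v
      have e2 : ∀ a, π a * (T π r f (Fin.cons a v) * T π s f (Fin.cons a v))
          = (T π r (avg π f) v * T π s (avg π f) v) * π a
          + (T π r (avg π f) v * s) * (π a * T π s (fun v => f (Fin.cons a v) - avg π f v) v)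
          + (T π s (avg π f) v * r) * (π a * T π r (fun v => f (Fin.cons a v) - avg π f v) v)
          + π a * (r * s * (T π r (fun v => f (Fin.cons a v) - avg π f v) v *
              T π s (fun v => f (Fin.cons a v) - avg π f v) v)) := by
        intro a
        rw [T_decomp, T_decomp]
        ring
      simp only [e2, Finset.sum_add_distrib, ← Finset.mul_sum, hr, hs, h1]
      ring

lemma geom_est {ρ γ : ℝ} (hρ0 : 0 ≤ ρ) (hρ : ρ < 1) (hγ0 : 0 ≤ γ) (hγ : γ ≤ 1) (k : ℕ) :
    0 ≤ ρ ^ k * (1 - (1 - γ)^k) ∧ ρ ^ k * (1 - (1 - γ)^k) ≤ γ / (1 - ρ) := by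
  have h1 : (1 - γ)^k ≤ 1 := pow_le_one₀ (by linarith) (by linarith)
  have h2 : 1 - (1 - γ)^k ≤ k * γ := by
    have := one_add_mul_le_pow (a := -γ) (by linarith) k
    have e : 1 + -γ = 1 - γ := by ring
    rw [e] at this
    linarith
  refine ⟨mul_nonneg (by positivity) (by linarith), ?_⟩
  have h3 : (k : ℝ) * ρ^k ≤ 1 / (1 - ρ) := by
    rw [le_div_iff₀ (by linarith)]
    have h4 : (k : ℝ) * ρ^k ≤ ∑ i ∈ Finset.range k, ρ ^ i := by
      calc (k : ℝ) * ρ^k = ∑ i ∈ Finset.range k, ρ ^ k := by simp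
        _ ≤ _ := Finset.sum_le_sum fun i hi =>
          pow_le_pow_of_le_one hρ0 hρ.le (Finset.mem_range.1 hi).le
    have h5 := geom_sum_mul ρ k
    have h6 : 0 ≤ ρ^k := by positivity
    nlinarith
  calc ρ ^ k * (1 - (1 - γ)^k) ≤ ρ^k * (k * γ) := mul_le_mul_of_nonneg_left h2 (by positivity)
    _ = γ * (k * ρ^k) := by ring
    _ ≤ γ * (1 / (1 - ρ)) := mul_le_mul_of_nonneg_left h3 hγ0
    _ = _ := by ring

lemma noise_est {π : Ω → ℝ} (hπ : ∀ a, 0 ≤ π a) (h1 : ∑ a, π a = 1) {ρ γ : ℝ}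
    (hρ0 : 0 ≤ ρ) (hρ : ρ < 1) (hγ0 : 0 ≤ γ) (hγ : γ ≤ 1) {n : ℕ}
    (f : (Fin n → Ω) → ℝ) (hf : ∀ v, f v ∈ Set.Icc (0:ℝ) 1) :
    exps π (fun v => (T π ρ (fun v => f v - T π (1 - γ) f v) v) ^ 2) ≤ (γ / (1 - ρ)) ^ 2 := by
  obtain ⟨w, hw, -, he⟩ := spec hπ h1 f
  have e1 : (fun v => (T π ρ (fun v => f v - T π (1 - γ) f v) v) ^ 2) = fun v =>
      (T π ρ f v * T π ρ f v - 2 * (T π ρ f v * T π (ρ * (1 - γ)) f v))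
        + T π (ρ * (1 - γ)) f v * T π (ρ * (1 - γ)) f v := by
    funext v
    rw [T_sub, T_comp h1]
    ring
  rw [e1, exps_add, exps_sub, exps_smul, he, he, he, Finset.mul_sum, ← Finset.sum_sub_distrib,
    ← Finset.sum_add_distrib]
  have hW : ∑ k ∈ Finset.range (n+1), w k ≤ 1 := by
    have h2 := he 1 1
    simp only [mul_one, one_pow, one_mul] at h2
    rw [← h2]
    refine le_trans (exps_mono hπ (g := fun _ => 1) (fun v => ?_)) (exps_const h1 1).le
    have := T_bounds hπ h1 zero_le_one le_rfl f hf v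
    nlinarith [this.1, this.2]
  calc _ ≤ ∑ k ∈ Finset.range (n+1), (γ / (1 - ρ)) ^ 2 * w k := by
        refine Finset.sum_le_sum fun k _ => ?_
        obtain ⟨g1, g2⟩ := geom_est hρ0 hρ hγ0 hγ k
        have : (ρ * ρ) ^ k * w k - 2 * ((ρ * (ρ * (1 - γ))) ^ k * w k)
            + (ρ * (1 - γ) * (ρ * (1 - γ))) ^ k * w k = (ρ ^ k * (1 - (1 - γ)^k))^2 * w k := by
          simp only [mul_pow]; ring
        rw [this]
        exact mul_le_mul_of_nonneg_right (pow_le_pow_left₀ g1 g2 2) (hw k)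
    _ = (γ / (1 - ρ)) ^ 2 * ∑ k ∈ Finset.range (n+1), w k := by rw [Finset.mul_sum]
    _ ≤ (γ / (1 - ρ)) ^ 2 * 1 := mul_le_mul_of_nonneg_left hW (sq_nonneg _)
    _ = _ := mul_one _

end Mart

/-! ### Correlation bounds -/

section Corr

variable {Ω : Type} [Fintype Ω] {ℓ : ℕ}

lemma covP_eq {P : (Fin ℓ → Ω) → ℝ} (hP : IsDist P) (f g : (Fin ℓ → Ω) → ℝ) :
    covP P f g = ∑ x, P x * ((f x - expP P f) * (g x - expP P g)) := by
  have e : ∀ x, P x * ((f x - expP P f) * (g x - expP P g))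
      = P x * (f x * g x) - expP P g * (P x * f x) - expP P f * (P x * g x)
        + expP P f * expP P g * P x := fun x => by ring
  simp only [e, Finset.sum_add_distrib, Finset.sum_sub_distrib, ← Finset.mul_sum, hP.2]
  have e1 : ∑ x, P x * f x = expP P f := rfl
  have e2 : ∑ x, P x * g x = expP P g := rfl
  rw [e1, e2]
  unfold covP
  have e3 : ∑ x, P x * (f x * g x) = expP P (fun x => f x * g x) := rfl
  rw [e3]
  ring

lemma varP_nonneg {P : (Fin ℓ → Ω) → ℝ} (hP : IsDist P) (f : (Fin ℓ → Ω) → ℝ) :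
    0 ≤ varP P f := by
  unfold varP
  rw [covP_eq hP]
  exact Finset.sum_nonneg fun x _ => mul_nonneg (hP.1 x) (mul_self_nonneg _)

lemma cov_cs {P : (Fin ℓ → Ω) → ℝ} (hP : IsDist P) (f g : (Fin ℓ → Ω) → ℝ) :
    (covP P f g)^2 ≤ varP P f * varP P g := by
  unfold varP
  rw [covP_eq hP, covP_eq hP, covP_eq hP]
  have := wcs hP.1 (fun x => f x - expP P f) (fun x => g x - expP P g)
  simpa only [sq] using this

lemma covP_smul (P : (Fin ℓ → Ω) → ℝ) (c d : ℝ) (f g : (Fin ℓ → Ω) → ℝ) :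
    covP P (fun x => c * f x) (fun x => d * g x) = c * d * covP P f g := by
  have e : ∀ (c : ℝ) (h : (Fin ℓ → Ω) → ℝ), expP P (fun x => c * h x) = c * expP P h := by
    intro c h
    unfold expP
    rw [Finset.mul_sum]
    exact Finset.sum_congr rfl fun x _ => by ring
  have e2 : (fun x => c * f x * (d * g x)) = fun x => c * d * (f x * g x) := by
    funext x; ring
  unfold covP
  rw [e2, e, e, e]
  ring

lemma rhoST_bdd {P : (Fin ℓ → Ω) → ℝ} (hP : IsDist P) (S U : Finset (Fin ℓ)) :
    BddAbove {r : ℝ | ∃ f g : (Fin ℓ → Ω) → ℝ, DependsOn f S ∧ DependsOn g U ∧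
    varP P f = 1 ∧ varP P g = 1 ∧ r = covP P f g} := by
  refine ⟨1, ?_⟩
  rintro r ⟨f, g, -, -, hf, hg, rfl⟩
  have := cov_cs hP f g
  rw [hf, hg] at this
  nlinarith

lemma rhoST_neg {P : (Fin ℓ → Ω) → ℝ} {S U : Finset (Fin ℓ)} {r : ℝ}
    (h : r ∈ {r : ℝ | ∃ f g : (Fin ℓ → Ω) → ℝ, DependsOn f S ∧ DependsOn g U ∧
    varP P f = 1 ∧ varP P g = 1 ∧ r = covP P f g}) :
    -r ∈ {r : ℝ | ∃ f g : (Fin ℓ → Ω) → ℝ, DependsOn f S ∧ DependsOn g U ∧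
    varP P f = 1 ∧ varP P g = 1 ∧ r = covP P f g} := by
  obtain ⟨f, g, hf, hg, vf, vg, rfl⟩ := h
  refine ⟨fun x => (-1) * f x, g, fun x y hxy => by simp only [hf x y hxy], hg, ?_, vg, ?_⟩
  · unfold varP; rw [covP_smul]; unfold varP at vf; rw [vf]; norm_num
  · have := covP_smul P (-1) 1 f g
    simp only [one_mul] at this
    rw [this]; ring

lemma rho_nonneg {P : (Fin ℓ → Ω) → ℝ} (hP : IsDist P) : 0 ≤ rho P := by
  refine Real.iSup_nonneg fun j => ?_
  unfold rhoST
  rcases Set.eq_empty_or_nonempty {r : ℝ | ∃ f g : (Fin ℓ → Ω) → ℝ, DependsOn f {j} ∧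
    DependsOn g {j}ᶜ ∧ varP P f = 1 ∧ varP P g = 1 ∧ r = covP P f g} with h | ⟨r, hr⟩
  · rw [h]; simp
  · have h1 := le_csSup (rhoST_bdd hP _ _) hr
    have h2 := le_csSup (rhoST_bdd hP _ _) (rhoST_neg hr)
    linarith

lemma corr {P : (Fin ℓ → Ω) → ℝ} (hP : IsDist P) {ρ : ℝ} (hρ : rho P ≤ ρ) (j : Fin ℓ)
    {f g : (Fin ℓ → Ω) → ℝ} (hf : DependsOn f {j}) (hg : DependsOn g {j}ᶜ) :
    (covP P f g)^2 ≤ ρ^2 * (varP P f * varP P g) := by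
  have hcs := cov_cs hP f g
  have vf := varP_nonneg hP f
  have vg := varP_nonneg hP g
  rcases vf.eq_or_lt with h | hf0
  · rw [← h] at hcs ⊢; simpa using hcs
  rcases vg.eq_or_lt with h | hg0
  · rw [← h] at hcs ⊢; simpa using hcs
  have sf : 0 < √(varP P f) := Real.sqrt_pos.2 hf0
  have sg : 0 < √(varP P g) := Real.sqrt_pos.2 hg0
  have qf := Real.mul_self_sqrt vf
  have qg := Real.mul_self_sqrt vg
  have nrm : ∀ h : (Fin ℓ → Ω) → ℝ, 0 < √(varP P h) → 0 ≤ varP P h →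
      varP P (fun x => (√(varP P h))⁻¹ * h x) = 1 := by
    intro h hs h0
    have e : varP P (fun x => (√(varP P h))⁻¹ * h x)
      = (√(varP P h))⁻¹ * (√(varP P h))⁻¹ * varP P h := covP_smul _ _ _ _ _
    have q := Real.mul_self_sqrt h0
    rw [e, ← mul_inv, q, inv_mul_cancel₀]
    rw [← q]; positivity
  have mem : (√(varP P f))⁻¹ * (√(varP P g))⁻¹ * covP P f g ∈
    {r : ℝ | ∃ f g : (Fin ℓ → Ω) → ℝ, DependsOn f {j} ∧ DependsOn g {j}ᶜ ∧
    varP P f = 1 ∧ varP P g = 1 ∧ r = covP P f g} :=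
    ⟨_, _, fun x y hxy => by simp only [hf x y hxy], fun x y hxy => by simp only [hg x y hxy],
      nrm f sf vf, nrm g sg vg, (covP_smul _ _ _ _ _).symm⟩
  have h0 : rhoST P {j} {j}ᶜ ≤ ρ :=
    (le_ciSup (f := fun j : Fin ℓ => rhoST P {j} {j}ᶜ) (Set.finite_range _).bddAbove j).trans hρ
  have h1 := (le_csSup (rhoST_bdd hP _ _) mem).trans h0
  have h2 := (le_csSup (rhoST_bdd hP _ _) (rhoST_neg mem)).trans h0
  have h3 : ((√(varP P f))⁻¹ * (√(varP P g))⁻¹ * covP P f g)^2 ≤ ρ^2 := by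
    apply sq_le_sq'
    · linarith
    · exact h1
  have e : ((√(varP P f))⁻¹ * (√(varP P g))⁻¹ * covP P f g)^2 * (varP P f * varP P g)
      = (covP P f g)^2 := by
    conv_lhs => rw [← qf, ← qg]
    simp only [Real.sqrt_mul_self sf.le, Real.sqrt_mul_self sg.le]
    field_simp
  calc _ = _ := e.symm
    _ ≤ _ := mul_le_mul_of_nonneg_right h3 (mul_nonneg vf vg)

lemma corr0 {P : (Fin ℓ → Ω) → ℝ} (hP : IsDist P) {ρ : ℝ} (hρ : rho P ≤ ρ) (j : Fin ℓ)
    {f g : (Fin ℓ → Ω) → ℝ} (hf : DependsOn f {j}) (hg : DependsOn g {j}ᶜ)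
    (hf0 : ∑ x, P x * f x = 0) :
    (∑ x, P x * (f x * g x))^2 ≤ ρ^2 * ((∑ x, P x * f x ^ 2) *
      ((∑ x, P x * g x ^ 2) - (∑ x, P x * g x)^2)) := by
  have := corr hP hρ j hf hg
  unfold varP covP expP at this
  rw [hf0] at this
  simp only [zero_mul, sub_zero] at this
  simpa only [← sq] using this

lemma var_lower {P : (Fin ℓ → Ω) → ℝ} {π : Ω → ℝ} (hP : IsDist P) (hm : HasMarginals P π)
    {ρ : ℝ} (hρ : rho P ≤ ρ) (t : Fin ℓ → Ω → ℝ) (ht : ∀ j, ∑ a, π a * t j a = 0) :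
    (1 - ρ^2) * ∑ j, ∑ a, π a * t j a ^ 2 ≤ ℓ * ∑ y, P y * (∑ j, t j (y j)) ^ 2 := by
  have key : ∀ k, (1 - ρ^2) * ∑ a, π a * t k a ^ 2 ≤ ∑ y, P y * (∑ j, t j (y j)) ^ 2 := by
    intro k
    set R : (Fin ℓ → Ω) → ℝ := fun y => ∑ j ∈ Finset.univ.erase k, t j (y j) with hR
    have hRd : DependsOn R {k}ᶜ := by
      intro x y hxy
      refine Finset.sum_congr rfl fun j hj => ?_
      rw [hxy j (by simpa using Finset.ne_of_mem_erase hj)]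
    have hud : DependsOn (fun y : Fin ℓ → Ω => t k (y k)) {k} := by
      intro x y hxy
      have := hxy k (by simp)
      simp only [this]
    have hu0 : ∑ y, P y * t k (y k) = 0 := by rw [marg_sum hm k]; exact ht k
    have hc := corr0 hP hρ k hud hRd hu0
    have hA : ∀ y : Fin ℓ → Ω, ∑ j, t j (y j) = t k (y k) + R y := fun y =>
      (Finset.add_sum_erase _ (fun j => t j (y j)) (Finset.mem_univ k)).symm
    have e : ∀ y, P y * (∑ j, t j (y j)) ^ 2 =
        P y * t k (y k) ^ 2 + 2 * (P y * (t k (y k) * R y)) + P y * R y ^ 2 := by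
      intro y; rw [hA]; ring
    simp only [e, Finset.sum_add_distrib, ← Finset.mul_sum]
    rw [← marg_sum hm k (fun a => t k a ^ 2)]
    have hU : 0 ≤ ∑ y, P y * t k (y k) ^ 2 :=
      Finset.sum_nonneg fun y _ => mul_nonneg (hP.1 y) (sq_nonneg _)
    have hV : 0 ≤ ∑ y, P y * R y ^ 2 :=
      Finset.sum_nonneg fun y _ => mul_nonneg (hP.1 y) (sq_nonneg _)
    generalize (∑ y, P y * t k (y k) ^ 2) = U at *
    generalize (∑ y, P y * R y ^ 2) = V at *
    generalize (∑ y, P y * (t k (y k) * R y)) = c at *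
    have h1 : c^2 ≤ ρ^2 * U * V := by
      have : ρ^2 * (U * (V - (∑ x, P x * R x)^2)) ≤ ρ^2 * (U * V) := by
        apply mul_le_mul_of_nonneg_left _ (sq_nonneg ρ)
        apply mul_le_mul_of_nonneg_left _ hU
        linarith [sq_nonneg (∑ x, P x * R x)]
      linarith
    have h2 : |2 * c| ≤ ρ^2 * U + V := by
      apply abs_le_of_sq_le_sq _ (by positivity)
      nlinarith [sq_nonneg (ρ^2 * U - V)]
    have := (abs_le.1 h2).1
    linarith
  calc _ = ∑ j, (1 - ρ^2) * ∑ a, π a * t j a ^ 2 := by rw [Finset.mul_sum]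
    _ ≤ ∑ j : Fin ℓ, ∑ y, P y * (∑ j, t j (y j)) ^ 2 := Finset.sum_le_sum fun k _ => key k
    _ = _ := by simp

end Corr

/-! ### The conditional kernel and smoothing -/

section Smooth

variable {Ω : Type} [Fintype Ω] {ℓ : ℕ}

/-- conditional law of the `j`-th coordinate given the others -/
noncomputable def condK (P : (Fin ℓ → Ω) → ℝ) (j : Fin ℓ) (y : Fin ℓ → Ω) (a : Ω) : ℝ :=
  P (Function.update y j a) / ∑ b, P (Function.update y j b)

lemma update_congr {x y : Fin ℓ → Ω} {j : Fin ℓ} (h : ∀ k ∈ ({j}ᶜ : Finset (Fin ℓ)), x k = y k)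
    (a : Ω) : Function.update x j a = Function.update y j a := by
  funext k
  by_cases hk : k = j
  · subst hk; simp
  · simp only [Function.update_of_ne hk]
    exact h k (by simpa using hk)

lemma cond_swap {P : (Fin ℓ → Ω) → ℝ} (hP : IsDist P) (j : Fin ℓ) (u : Ω → ℝ)
    {G : (Fin ℓ → Ω) → ℝ} (hG : DependsOn G {j}ᶜ) :
    ∑ y, P y * (u (y j) * G y) = ∑ y, P y * ((∑ a, condK P j y a * u a) * G y) := by
  have inv : Function.Involutive (fun p : (Fin ℓ → Ω) × Ω => (Function.update p.1 j p.2, p.1 j)) := by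
    rintro ⟨y, a⟩
    simp
  have hm : ∀ y a, ∑ b, P (Function.update (Function.update y j a) j b)
      = ∑ b, P (Function.update y j b) := by
    intro y a; simp
  have hGu : ∀ y a, G (Function.update y j a) = G y := by
    intro y a
    apply hG
    intro k hk
    have : k ≠ j := by simpa using hk
    simp [this]
  have e1 : ∑ y, P y * ((∑ a, condK P j y a * u a) * G y)
      = ∑ p : (Fin ℓ → Ω) × Ω, P p.1 * (condK P j p.1 p.2 * u p.2 * G p.1) := by
    rw [Fintype.sum_prod_type]
    simp only [Finset.sum_mul, Finset.mul_sum]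
  rw [e1, ← Equiv.sum_comp (Function.Involutive.toPerm _ inv), Fintype.sum_prod_type]
  refine Finset.sum_congr rfl fun y _ => ?_
  simp only [Function.Involutive.coe_toPerm, condK, hGu, Function.update_idem,
    Function.update_eq_self]
  rw [← Finset.sum_mul]
  by_cases h0 : ∑ b, P (Function.update y j b) = 0
  · have : P y = 0 := by
      have := (Finset.sum_eq_zero_iff_of_nonneg (fun b _ => hP.1 _)).1 h0 (y j) (Finset.mem_univ _)
      simpa using this
    rw [this, h0]; simp
  · field_simp

lemma cond_dep (P : (Fin ℓ → Ω) → ℝ) (j : Fin ℓ) (u : Ω → ℝ) :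
    DependsOn (fun y => ∑ a, condK P j y a * u a) {j}ᶜ := by
  intro x y hxy
  simp only [condK, update_congr hxy]

lemma cond_sq {P : (Fin ℓ → Ω) → ℝ} {π : Ω → ℝ} (hP : IsDist P) (hm : HasMarginals P π)
    (h1 : ∑ a, π a = 1) {ρ : ℝ} (hρ : rho P ≤ ρ) (j : Fin ℓ) (u : Ω → ℝ) :
    ∑ y, P y * (∑ a, condK P j y a * u a) ^ 2 ≤ ∑ b, π b * (∑ a, nk π ρ b a * u a) ^ 2 := by
  simp only [nk_sum]
  set G : (Fin ℓ → Ω) → ℝ := fun y => ∑ a, condK P j y a * u a with hGdef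
  have hG : DependsOn G {j}ᶜ := cond_dep P j u
  set m := ∑ a, π a * u a with hmd
  have hGm : ∑ y, P y * G y = m := by
    have := cond_swap hP j u (G := fun _ => 1) (fun _ _ _ => rfl)
    simp only [mul_one] at this
    rw [← this, marg_sum hm j]
  have hX : ∑ y, P y * (u (y j) * G y) = ∑ y, P y * G y ^ 2 := by
    rw [cond_swap hP j u hG]
    exact Finset.sum_congr rfl fun y _ => by rw [sq]
  have hf0 : ∑ y, P y * (u (y j) - m) = 0 := by
    rw [marg_sum hm j (fun a => u a - m)]
    simp only [mul_sub, Finset.sum_sub_distrib, ← Finset.sum_mul, h1]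
    rw [← hmd]; ring
  have hc := corr0 hP hρ j (f := fun y => u (y j) - m)
    (fun x y hxy => by simp only [hxy j (by simp)]) hG hf0
  have hV : ∑ y, P y * (u (y j) - m) ^ 2 = (∑ a, π a * u a ^ 2) - m^2 := by
    rw [marg_sum hm j (fun a => (u a - m)^2)]
    have e : ∀ a, π a * (u a - m)^2 = π a * u a ^ 2 - 2 * m * (π a * u a) + m^2 * π a :=
      fun a => by ring
    simp only [e, Finset.sum_add_distrib, Finset.sum_sub_distrib, ← Finset.mul_sum, h1]
    rw [← hmd]; ring
  have hE : ∑ y, P y * ((u (y j) - m) * G y) = (∑ y, P y * G y ^ 2) - m^2 := by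
    have e : ∀ y, P y * ((u (y j) - m) * G y) = P y * (u (y j) * G y) - m * (P y * G y) :=
      fun y => by ring
    simp only [e, Finset.sum_sub_distrib, ← Finset.mul_sum, hX, hGm]
    ring
  have hR : ∑ b, π b * (ρ * u b + (1 - ρ) * m) ^ 2
      = ρ^2 * ((∑ a, π a * u a ^ 2) - m^2) + m^2 := by
    have e : ∀ b, π b * (ρ * u b + (1 - ρ) * m) ^ 2 = ρ^2 * (π b * u b ^2)
        + 2 * ρ * (1 - ρ) * m * (π b * u b) + (1 - ρ)^2 * m^2 * π b := fun b => by ring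
    simp only [e, Finset.sum_add_distrib, ← Finset.mul_sum, h1]
    rw [← hmd]; ring
  rw [hE, hV, hGm] at hc
  rw [hR]
  have hJ := wjensen hP.1 hP.2 G
  rw [hGm] at hJ
  rcases hJ.eq_or_lt with h | h
  · rw [← h]
    have : 0 ≤ (∑ a, π a * u a ^ 2) - m^2 := by
      rw [← hV]
      exact Finset.sum_nonneg fun y _ => mul_nonneg (hP.1 y) (sq_nonneg _)
    nlinarith [sq_nonneg ρ]
  · have hpos : 0 < (∑ y, P y * G y ^ 2) - m^2 := by linarith
    have : (∑ y, P y * G y ^ 2) - m^2 ≤ ρ^2 * ((∑ a, π a * u a ^ 2) - m^2) := by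
      refine le_of_mul_le_mul_right ?_ hpos
      nlinarith
    linarith

lemma ker_swap {P : (Fin ℓ → Ω) → ℝ} (hP : IsDist P) (j : Fin ℓ) {n : ℕ} (h : (Fin n → Ω) → ℝ)
    (G : (Fin n → Fin ℓ → Ω) → ℝ)
    (hG : ∀ x x' : Fin n → Fin ℓ → Ω, (∀ i, ∀ k ∈ ({j}ᶜ : Finset (Fin ℓ)), x i k = x' i k) → G x = G x') :
    exps P (fun x => h (fun i => x i j) * G x) = exps P (fun x => ker (condK P j) n h x * G x) := by
  induction n with
  | zero =>
    rw [exps_zero _ _ (fun i => i.elim0), exps_zero _ _ (fun i => i.elim0)]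
    simp only [ker]
    congr 2
    funext i
    exact i.elim0
  | succ n ih =>
    rw [exps_succ, exps_succ]
    simp only [cons_proj, ker_cons]
    have e1 : ∀ y : Fin ℓ → Ω, exps P (fun x : Fin n → Fin ℓ → Ω =>
        h (Fin.cons (y j) (fun i => x i j)) * G (Fin.cons y x))
        = exps P (fun x => ker (condK P j) n (fun v => h (Fin.cons (y j) v)) x * G (Fin.cons y x)) := by
      intro y
      apply ih (fun v => h (Fin.cons (y j) v)) (fun x => G (Fin.cons y x))
      intro x x' hx
      apply hG
      intro i
      refine Fin.cases ?_ (fun i => ?_) i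
      · intro k _; simp
      · intro k hk; simpa using hx i k hk
    simp only [e1]
    rw [← exps_wsum, ← exps_wsum]
    congr 1
    funext x
    refine cond_swap hP j (fun a => ker (condK P j) n (fun v => h (Fin.cons a v)) x)
      (G := fun y => G (Fin.cons y x)) ?_
    intro y y' hy
    apply hG
    intro i
    refine Fin.cases ?_ (fun i => ?_) i
    · intro k hk; simpa using hy k hk
    · intro k hk; simp

lemma ker_sq {P : (Fin ℓ → Ω) → ℝ} {π : Ω → ℝ} (hP : IsDist P) (hm : HasMarginals P π)
    (hπ : ∀ a, 0 ≤ π a)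
    (h1 : ∑ a, π a = 1) {ρ : ℝ} (hρ : rho P ≤ ρ) (j : Fin ℓ) {n : ℕ} (h : (Fin n → Ω) → ℝ) :
    exps P (fun x => (ker (condK P j) n h x) ^ 2) ≤ exps π (fun v => (T π ρ h v)^2) := by
  induction n with
  | zero =>
    rw [exps_zero _ _ (fun i => i.elim0), exps_zero _ _ (fun i => i.elim0)]
    simp only [T, ker]
    exact le_rfl
  | succ n ih =>
    calc exps P (fun x => (ker (condK P j) (n+1) h x) ^ 2)
        = exps P (fun x : Fin n → Fin ℓ → Ω => ∑ y, P y * (∑ a, condK P j y a *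
            ker (condK P j) n (fun v => h (Fin.cons a v)) x) ^ 2) := by
          rw [exps_succ, ← exps_wsum]
          simp only [ker_cons]
      _ ≤ exps P (fun x : Fin n → Fin ℓ → Ω => ∑ b, π b * (∑ a, nk π ρ b a *
            ker (condK P j) n (fun v => h (Fin.cons a v)) x) ^ 2) :=
          exps_mono hP.1 fun x => cond_sq hP hm h1 hρ j _
      _ = ∑ b, π b * exps P (fun x : Fin n → Fin ℓ → Ω =>
            (ker (condK P j) n (fun v => ∑ a, nk π ρ b a * h (Fin.cons a v)) x) ^ 2) := by
          rw [exps_wsum]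
          simp only [ker_wsum]
      _ ≤ ∑ b, π b * exps π (fun v => (T π ρ (fun v => ∑ a, nk π ρ b a * h (Fin.cons a v)) v) ^ 2) :=
          Finset.sum_le_sum fun b _ => mul_le_mul_of_nonneg_left (ih _) (hπ b)
      _ = _ := by
          rw [exps_succ]
          refine Finset.sum_congr rfl fun b _ => ?_
          simp only [T_wsum]
          simp only [T, ker_cons]

lemma swap_err {P : (Fin ℓ → Ω) → ℝ} {π : Ω → ℝ} (hP : IsDist P) (hm : HasMarginals P π)
    (hπ : ∀ a, 0 ≤ π a) (h1 : ∑ a, π a = 1) {ρ γ : ℝ} (hρ : rho P ≤ ρ) (hρ1 : ρ < 1)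
    (hγ0 : 0 ≤ γ) (hγ : γ ≤ 1) (j : Fin ℓ) {n : ℕ}
    (f : (Fin n → Ω) → ℝ) (hf : ∀ v, f v ∈ Set.Icc (0:ℝ) 1)
    (G : (Fin n → Fin ℓ → Ω) → ℝ) (hG01 : ∀ x, G x ∈ Set.Icc (0:ℝ) 1)
    (hG : ∀ x x' : Fin n → Fin ℓ → Ω, (∀ i, ∀ k ∈ ({j}ᶜ : Finset (Fin ℓ)), x i k = x' i k) → G x = G x') :
    |exps P (fun x => (f (fun i => x i j) - T π (1 - γ) f (fun i => x i j)) * G x)|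
      ≤ γ / (1 - ρ) := by
  have hρ0 : 0 ≤ ρ := (rho_nonneg hP).trans hρ
  have h0 : 0 ≤ γ / (1 - ρ) := div_nonneg hγ0 (by linarith)
  apply abs_le_of_sq_le_sq _ h0
  have e := ker_swap hP j (fun v => f v - T π (1 - γ) f v) G hG
  rw [e]
  refine (exps_cs hP.1 _ _).trans ?_
  have a1 := (ker_sq hP hm hπ h1 hρ j (fun v => f v - T π (1 - γ) f v)).trans
    (noise_est hπ h1 hρ0 hρ1 hγ0 hγ f hf)
  have a2 : exps P (fun x => G x ^ 2) ≤ 1 := by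
    refine le_trans (exps_mono hP.1 (g := fun _ => 1) (fun x => ?_)) (exps_const hP.2 1).le
    have := hG01 x
    nlinarith [this.1, this.2]
  have a3 : 0 ≤ exps P (fun x => G x ^ 2) := exps_nonneg hP.1 fun x => sq_nonneg _
  have a4 : 0 ≤ (γ / (1 - ρ))^2 := sq_nonneg _
  calc _ ≤ (γ / (1 - ρ))^2 * 1 := mul_le_mul a1 a2 a3 a4
    _ = _ := mul_one _

lemma smooth_err {P : (Fin ℓ → Ω) → ℝ} {π : Ω → ℝ} (hP : IsDist P) (hm : HasMarginals P π)
    (hπ : ∀ a, 0 ≤ π a) (h1 : ∑ a, π a = 1) {ρ γ : ℝ} (hρ : rho P ≤ ρ) (hρ1 : ρ < 1)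
    (hγ0 : 0 ≤ γ) (hγ : γ ≤ 1) {n : ℕ}
    (f : Fin ℓ → (Fin n → Ω) → ℝ) (hf : ∀ j v, f j v ∈ Set.Icc (0:ℝ) 1) :
    exps P (fun x : Fin n → Fin ℓ → Ω => ∏ j, T π (1 - γ) (f j) (fun i => x i j)) - ℓ * (γ / (1 - ρ))
      ≤ exps P (fun x : Fin n → Fin ℓ → Ω => ∏ j, f j (fun i => x i j)) := by
  classical
  have key : ∀ s : Finset (Fin ℓ), exps P (fun x : Fin n → Fin ℓ → Ω =>
      ∏ j, (if j ∈ s then T π (1 - γ) (f j) else f j) (fun i => x i j)) - s.card * (γ / (1 - ρ))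
      ≤ exps P (fun x : Fin n → Fin ℓ → Ω => ∏ j, f j (fun i => x i j)) := by
    intro s
    induction s using Finset.induction_on with
    | empty => simp
    | insert k s hk ih =>
      rw [Finset.card_insert_of_notMem hk]
      refine le_trans ?_ ih
      set F : Fin ℓ → (Fin n → Ω) → ℝ := fun j => if j ∈ s then T π (1 - γ) (f j) else f j with hF
      have hF01 : ∀ j v, F j v ∈ Set.Icc (0:ℝ) 1 := by
        intro j v
        simp only [hF]
        split_ifs
        · exact T_bounds hπ h1 (by linarith) (by linarith) (f j) (hf j) v
        · exact hf j v
      have hG := swap_err hP hm hπ h1 hρ hρ1 hγ0 hγ k (f k) (hf k)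
        (fun x => ∏ j ∈ Finset.univ.erase k, F j (fun i => x i j))
        (fun x => ⟨Finset.prod_nonneg fun j _ => (hF01 j _).1,
          Finset.prod_le_one (fun j _ => (hF01 j _).1) fun j _ => (hF01 j _).2⟩)
        (fun x x' hx => Finset.prod_congr rfl fun j hj => by
          have : ∀ i, x i j = x' i j := fun i => hx i j (by simpa using Finset.ne_of_mem_erase hj)
          simp only [this])
      have e1 : ∀ x : Fin n → Fin ℓ → Ω, ∏ j, F j (fun i => x i j)
          = f k (fun i => x i k) * ∏ j ∈ Finset.univ.erase k, F j (fun i => x i j) := by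
        intro x
        rw [← Finset.mul_prod_erase _ (fun j => F j (fun i => x i j)) (Finset.mem_univ k)]
        simp only [hF, if_neg hk]
      have e2 : ∀ x : Fin n → Fin ℓ → Ω,
          ∏ j, (if j ∈ insert k s then T π (1 - γ) (f j) else f j) (fun i => x i j)
          = T π (1 - γ) (f k) (fun i => x i k)
            * ∏ j ∈ Finset.univ.erase k, F j (fun i => x i j) := by
        intro x
        rw [← Finset.mul_prod_erase _ (fun j => (if j ∈ insert k s then T π (1 - γ) (f j)
          else f j) (fun i => x i j)) (Finset.mem_univ k)]
        congr 1
        · simp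
        · refine Finset.prod_congr rfl fun j hj => ?_
          have : j ≠ k := Finset.ne_of_mem_erase hj
          simp [hF, this]
      change _ ≤ exps P (fun x : Fin n → Fin ℓ → Ω => ∏ j, F j (fun i => x i j)) - _
      simp only [e1, e2]
      simp only [sub_mul] at hG
      rw [exps_sub] at hG
      have := (abs_le.1 hG).1
      push_cast
      linarith
  have := key Finset.univ
  simpa using this

end Smooth

/-! ### The local inequality and the main induction -/

section Local

/-- the cubic error constant -/
noncomputable def K1 (ℓ : ℕ) (δ s : ℝ) : ℝ :=
  s / δ + s^2 * (1 + (ℓ / δ) / δ) + s^3 * (1 + (1 + (ℓ / δ) / δ) * (ℓ / δ))^3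

lemma K1_nonneg (ℓ : ℕ) {δ s : ℝ} (hδ : 0 < δ) (hs : 0 ≤ s) : 0 ≤ K1 ℓ δ s := by
  unfold K1; positivity

lemma prod_lower {ℓ : ℕ} (t : Fin ℓ → ℝ) {δ s : ℝ} (hδ : 0 < δ) (hδ1 : δ ≤ 1)
    (ht : ∀ j, δ ≤ 1 + t j) (ht' : ∀ j, |t j| ≤ 1 / δ) (hs : 0 ≤ s) :
    1 + s * (∑ j, t j) + (s^2 * (∑ j, t j)^2 - s * ∑ j, t j ^ 2) / 2
      - K1 ℓ δ s * (∑ j, |t j|)^3 ≤ ∏ j, (1 + t j) ^ s := by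
  set A := ∑ j, t j with hA
  set B := ∑ j, t j ^ 2 with hB
  set c := ∑ j, |t j| ^ 3 with hc
  set Q := ∑ j, |t j| with hQ
  set M : ℝ := ℓ / δ with hM
  set H := 1 + M / δ with hH
  have hM0 : 0 ≤ M := by positivity
  have hH0 : 0 ≤ H := by positivity
  have hQ0 : 0 ≤ Q := Finset.sum_nonneg fun j _ => abs_nonneg _
  have hle : ∀ j, |t j| ≤ Q := fun j =>
    Finset.single_le_sum (f := fun j => |t j|) (fun j _ => abs_nonneg _) (Finset.mem_univ j)
  have hAQ : |A| ≤ Q := Finset.abs_sum_le_sum_abs _ _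
  have hB0 : 0 ≤ B := Finset.sum_nonneg fun j _ => sq_nonneg _
  have hc0 : 0 ≤ c := Finset.sum_nonneg fun j _ => by positivity
  have hBQ : B ≤ Q^2 := by
    calc B ≤ ∑ j, |t j| * Q := Finset.sum_le_sum fun j _ => by
          rw [← sq_abs, sq]; exact mul_le_mul_of_nonneg_left (hle j) (abs_nonneg _)
      _ = Q^2 := by rw [← Finset.sum_mul, sq]
  have hcQ : c ≤ Q^3 := by
    calc c ≤ ∑ j, |t j| * Q^2 := Finset.sum_le_sum fun j _ => by
          rw [pow_succ' (|t j|) 2]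
          exact mul_le_mul_of_nonneg_left (pow_le_pow_left₀ (abs_nonneg _) (hle j) 2) (abs_nonneg _)
      _ = Q^3 := by rw [← Finset.sum_mul]; ring
  have hQM : Q ≤ M := by
    calc Q ≤ ∑ j : Fin ℓ, 1 / δ := Finset.sum_le_sum fun j _ => ht' j
      _ = M := by simp [hM]; ring
  set W := B / 2 + c / δ with hW
  have hW0 : 0 ≤ W := by positivity
  have hWQ : W ≤ H * Q^2 := by
    have h1 : c / δ ≤ M / δ * Q^2 := by
      rw [div_mul_eq_mul_div]
      apply div_le_div_of_nonneg_right _ hδ.le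
      calc c ≤ Q^3 := hcQ
        _ = Q * Q^2 := by ring
        _ ≤ M * Q^2 := mul_le_mul_of_nonneg_right hQM (sq_nonneg _)
    have : H * Q^2 = Q^2 + M / δ * Q^2 := by rw [hH]; ring
    rw [this]
    have := sq_nonneg Q
    linarith
  set Z := s * (A - W) with hZ
  have hprod : Real.exp Z ≤ ∏ j, (1 + t j) ^ s := by
    have e : ∏ j, (1 + t j) ^ s = Real.exp (s * ∑ j, Real.log (1 + t j)) := by
      rw [Finset.mul_sum, Real.exp_sum]
      refine Finset.prod_congr rfl fun j _ => ?_
      rw [Real.rpow_def_of_pos (by linarith [ht j]), mul_comm]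
    rw [e]
    apply Real.exp_le_exp.2
    apply mul_le_mul_of_nonneg_left _ hs
    have e2 : A - W = ∑ j, (t j - t j ^ 2 / 2 - |t j| ^ 3 / δ) := by
      rw [Finset.sum_sub_distrib, Finset.sum_sub_distrib, ← Finset.sum_div, ← Finset.sum_div]
      rw [hW]; ring
    rw [e2]
    exact Finset.sum_le_sum fun j _ => log_lower hδ (ht j) hδ1
  refine le_trans ?_ hprod
  refine le_trans ?_ (exp_cubic Z)
  have hZabs : |Z| ≤ s * (Q * (1 + H * M)) := by
    rw [hZ, abs_mul, abs_of_nonneg hs]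
    apply mul_le_mul_of_nonneg_left _ hs
    calc |A - W| ≤ |A| + |W| := abs_sub _ _
      _ ≤ Q + H * Q^2 := by rw [abs_of_nonneg hW0]; linarith
      _ ≤ Q * (1 + H * M) := by
        have : H * Q * Q ≤ H * Q * M := mul_le_mul_of_nonneg_left hQM (by positivity)
        nlinarith
  have hZ3 : |Z|^3 ≤ s^3 * (1 + H * M)^3 * Q^3 := by
    calc |Z|^3 ≤ (s * (Q * (1 + H * M)))^3 := pow_le_pow_left₀ (abs_nonneg _) hZabs 3
      _ = _ := by ring
  have hZ2 : s^2 * A^2 / 2 - s^2 * H * Q^3 ≤ Z^2/2 := by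
    have h1 : A * W ≤ H * Q^3 := by
      calc A * W ≤ |A| * W := mul_le_mul_of_nonneg_right (le_abs_self _) hW0
        _ ≤ Q * (H * Q^2) := mul_le_mul hAQ hWQ hW0 hQ0
        _ = _ := by ring
    have h2 : s^2 * (A * W) ≤ s^2 * (H * Q^3) := mul_le_mul_of_nonneg_left h1 (sq_nonneg _)
    have h3 : Z^2/2 = s^2 * A^2/2 - s^2 * (A * W) + s^2 * W^2 / 2 := by rw [hZ]; ring
    rw [h3]
    have : 0 ≤ s^2 * W^2 / 2 := by positivity
    linarith
  have hZ1 : s * A - s * B / 2 - s / δ * Q^3 ≤ Z := by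
    have h1 : s / δ * c ≤ s / δ * Q^3 := mul_le_mul_of_nonneg_left hcQ (by positivity)
    have h2 : Z = s * A - s * B / 2 - s / δ * c := by rw [hZ, hW]; ring
    rw [h2]; linarith
  have hK : K1 ℓ δ s * Q^3 = s / δ * Q^3 + s^2 * H * Q^3 + s^3 * (1 + H * M)^3 * Q^3 := by
    unfold K1; rw [← hM, ← hH]; ring
  rw [hK]
  linarith

variable {Ω : Type} [Fintype Ω] {ℓ : ℕ}

lemma local_ineq {P : (Fin ℓ → Ω) → ℝ} {π : Ω → ℝ} (hP : IsDist P) (hm : HasMarginals P π)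
    (hπ : ∀ a, 0 ≤ π a) (h1 : ∑ a, π a = 1) {ρ δ η s : ℝ} (hρ : rho P ≤ ρ) (hρ1 : ρ < 1)
    (hδ : 0 < δ) (hδ1 : δ ≤ 1) (hη0 : 0 ≤ η) (hη1 : η ≤ 1) (hs : s = ℓ / (1 - ρ^2))
    (A : Fin ℓ → Ω → ℝ) (hA : ∀ j b, A j b ∈ Set.Icc δ 1) (a : Fin ℓ → ℝ)
    (ha : ∀ j, ∑ b, π b * A j b = a j) :
    ∏ j, (a j) ^ s - K1 ℓ δ s * ℓ^2 / δ^3 * ∑ j, ∑ b, π b * |A j b - a j| ^ (2 + η)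
      ≤ ∑ y, P y * ∏ j, (A j (y j)) ^ s := by
  have hρ0 : 0 ≤ ρ := (rho_nonneg hP).trans hρ
  have hρ2 : 0 < 1 - ρ^2 := by nlinarith
  have hs0 : 0 ≤ s := by rw [hs]; positivity
  have ha' : ∀ j, a j ∈ Set.Icc δ 1 := by
    intro j
    rw [← ha j]
    constructor
    · calc δ = ∑ b, π b * δ := by rw [← Finset.sum_mul, h1, one_mul]
        _ ≤ _ := Finset.sum_le_sum fun b _ => mul_le_mul_of_nonneg_left (hA j b).1 (hπ b)
    · calc _ ≤ ∑ b, π b * 1 :=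
          Finset.sum_le_sum fun b _ => mul_le_mul_of_nonneg_left (hA j b).2 (hπ b)
        _ = 1 := by rw [← Finset.sum_mul, h1, one_mul]
  have hap : ∀ j, 0 < a j := fun j => hδ.trans_le (ha' j).1
  set t : Fin ℓ → Ω → ℝ := fun j b => (A j b - a j) / a j with ht
  have hAt : ∀ j b, A j b = a j * (1 + t j b) := by
    intro j b
    have := (hap j).ne'
    simp only [ht]; field_simp; ring
  have hd1 : ∀ j b, |A j b - a j| ≤ 1 := by
    intro j b
    rw [abs_le]
    have := hA j b; have h2 := ha' j
    constructor <;> linarith [this.1, this.2, h2.1, h2.2]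
  have htd : ∀ j b, |t j b| ≤ |A j b - a j| / δ := by
    intro j b
    simp only [ht]
    rw [abs_div, abs_of_pos (hap j)]
    exact div_le_div_of_nonneg_left (abs_nonneg _) hδ (ha' j).1
  have ht1 : ∀ j b, |t j b| ≤ 1 / δ := fun j b =>
    (htd j b).trans (div_le_div_of_nonneg_right (hd1 j b) hδ.le)
  have htl : ∀ j b, δ ≤ 1 + t j b := by
    intro j b
    have e : 1 + t j b = A j b / a j := by
      rw [hAt]; have := (hap j).ne'; field_simp
    rw [e, le_div_iff₀ (hap j)]
    nlinarith [(hA j b).1, (ha' j).2]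
  have htm : ∀ j, ∑ b, π b * t j b = 0 := by
    intro j
    have e : ∀ b, π b * t j b = (π b * A j b - a j * π b) / a j := fun b => by
      simp only [ht]; ring
    simp only [e]
    rw [← Finset.sum_div, Finset.sum_sub_distrib, ← Finset.mul_sum, h1, ha j]
    simp
  set Φ := ∏ j, (a j) ^ s with hΦ
  have hΦ0 : 0 ≤ Φ := Finset.prod_nonneg fun j _ => Real.rpow_nonneg (hap j).le _
  have hΦ1 : Φ ≤ 1 := Finset.prod_le_one (fun j _ => Real.rpow_nonneg (hap j).le _)
    fun j _ => Real.rpow_le_one (hap j).le (ha' j).2 hs0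
  have hfac : ∀ y : Fin ℓ → Ω, ∏ j, (A j (y j)) ^ s = Φ * ∏ j, (1 + t j (y j)) ^ s := by
    intro y
    rw [hΦ, ← Finset.prod_mul_distrib]
    refine Finset.prod_congr rfl fun j _ => ?_
    rw [hAt j, Real.mul_rpow (hap j).le (by linarith [htl j (y j)])]
  have hK0 := K1_nonneg ℓ hδ hs0
  set E3 := ∑ j, ∑ b, π b * |A j b - a j| ^ (2 + η) with hE3
  have hcube : ∀ y : Fin ℓ → Ω, (∑ j, |t j (y j)|)^3 ≤ ℓ^2 * ∑ j, |t j (y j)|^3 := by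
    intro y
    rcases Nat.eq_zero_or_pos ℓ with h | h
    · subst h; simp
    have h2 := pow_sum_div_card_le_sum_pow (s := Finset.univ) (f := fun j => |t j (y j)|)
      (fun j _ => abs_nonneg _) 2
    have h3 : (0:ℝ) < (ℓ:ℝ)^2 := by positivity
    simp only [Finset.card_univ, Fintype.card_fin] at h2
    rw [div_le_iff₀ h3] at h2
    rw [mul_comm]
    exact h2
  have h3E : ∑ y, P y * (∑ j, |t j (y j)|)^3 ≤ ℓ^2 / δ^3 * E3 := by
    calc ∑ y, P y * (∑ j, |t j (y j)|)^3
        ≤ ∑ y, P y * (ℓ^2 * ∑ j, |t j (y j)|^3) :=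
          Finset.sum_le_sum fun y _ => mul_le_mul_of_nonneg_left (hcube y) (hP.1 y)
      _ = ℓ^2 * ∑ j, ∑ b, π b * |t j b|^3 := by
          have : ∀ j, ∑ b, π b * |t j b|^3 = ∑ y, P y * |t j (y j)|^3 := fun j =>
            (marg_sum hm j (fun b => |t j b|^3)).symm
          simp only [this]
          rw [Finset.sum_comm, Finset.mul_sum]
          refine Finset.sum_congr rfl fun y _ => ?_
          rw [← Finset.mul_sum]; ring
      _ ≤ ℓ^2 * ∑ j, ∑ b, π b * (|A j b - a j| ^ (2 + η) / δ^3) := by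
          apply mul_le_mul_of_nonneg_left _ (by positivity)
          refine Finset.sum_le_sum fun j _ => Finset.sum_le_sum fun b _ =>
            mul_le_mul_of_nonneg_left ?_ (hπ b)
          calc |t j b|^3 ≤ (|A j b - a j| / δ)^3 := pow_le_pow_left₀ (abs_nonneg _) (htd j b) 3
            _ = |A j b - a j|^3 / δ^3 := by rw [div_pow]
            _ ≤ _ := by
              apply div_le_div_of_nonneg_right _ (by positivity)
              rw [← Real.rpow_natCast]
              exact Real.rpow_le_rpow_of_exponent_ge' (abs_nonneg _) (hd1 j b) (by linarith)
                (by push_cast; linarith)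
      _ = _ := by
          rw [hE3]
          simp only [Finset.mul_sum]
          exact Finset.sum_congr rfl fun j _ => Finset.sum_congr rfl fun b _ => by ring
  have hvar := var_lower hP hm hρ t htm
  have hlow : 1 - K1 ℓ δ s * (ℓ^2 / δ^3 * E3) ≤ ∑ y, P y * ∏ j, (1 + t j (y j)) ^ s := by
    have step : ∑ y, P y * (1 + s * (∑ j, t j (y j)) + (s^2 * (∑ j, t j (y j))^2
        - s * ∑ j, t j (y j) ^ 2) / 2 - K1 ℓ δ s * (∑ j, |t j (y j)|)^3)
        ≤ ∑ y, P y * ∏ j, (1 + t j (y j)) ^ s :=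
      Finset.sum_le_sum fun y _ => mul_le_mul_of_nonneg_left
        (prod_lower (fun j => t j (y j)) hδ hδ1 (fun j => htl j _) (fun j => ht1 j _) hs0) (hP.1 y)
    refine le_trans ?_ step
    have e : ∀ y, P y * (1 + s * (∑ j, t j (y j)) + (s^2 * (∑ j, t j (y j))^2
        - s * ∑ j, t j (y j) ^ 2) / 2 - K1 ℓ δ s * (∑ j, |t j (y j)|)^3)
        = P y + s * (P y * ∑ j, t j (y j)) + s^2/2 * (P y * (∑ j, t j (y j))^2)
          - s/2 * (P y * ∑ j, t j (y j)^2) - K1 ℓ δ s * (P y * (∑ j, |t j (y j)|)^3) :=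
      fun y => by ring
    simp only [e, Finset.sum_add_distrib, Finset.sum_sub_distrib]
    simp only [← Finset.mul_sum, hP.2]
    have m1 : ∑ y, P y * ∑ j, t j (y j) = 0 := by
      simp only [Finset.mul_sum]
      rw [Finset.sum_comm]
      exact Finset.sum_eq_zero fun j _ => by rw [marg_sum hm j, htm]
    have m2 : ∑ y, P y * ∑ j, t j (y j)^2 = ∑ j, ∑ b, π b * t j b ^ 2 := by
      simp only [Finset.mul_sum]
      rw [Finset.sum_comm]
      exact Finset.sum_congr rfl fun j _ => marg_sum hm j (fun b => t j b ^ 2)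
    rw [m1, m2]
    have hB : ∑ j, ∑ b, π b * t j b ^ 2 ≤ s * ∑ y, P y * (∑ j, t j (y j)) ^ 2 := by
      rw [hs, div_mul_eq_mul_div, le_div_iff₀ hρ2]
      linarith
    have h5 : s/2 * ∑ j, ∑ b, π b * t j b ^ 2 ≤ s/2 * (s * ∑ y, P y * (∑ j, t j (y j)) ^ 2) :=
      mul_le_mul_of_nonneg_left hB (by linarith)
    have h6 := mul_le_mul_of_nonneg_left h3E hK0
    have e7 : s/2 * (s * ∑ y, P y * (∑ j, t j (y j)) ^ 2)
      = s^2/2 * ∑ y, P y * (∑ j, t j (y j)) ^ 2 := by ring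
    linarith
  have hE30 : 0 ≤ E3 := Finset.sum_nonneg fun j _ => Finset.sum_nonneg fun b _ =>
    mul_nonneg (hπ b) (Real.rpow_nonneg (abs_nonneg _) _)
  have hX0 : 0 ≤ K1 ℓ δ s * (ℓ^2 / δ^3 * E3) := by positivity
  calc Φ - K1 ℓ δ s * ℓ^2 / δ^3 * E3 = Φ - K1 ℓ δ s * (ℓ^2 / δ^3 * E3) := by ring
    _ ≤ Φ * (1 - K1 ℓ δ s * (ℓ^2 / δ^3 * E3)) := by nlinarith
    _ ≤ Φ * ∑ y, P y * ∏ j, (1 + t j (y j)) ^ s := mul_le_mul_of_nonneg_left hlow hΦ0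
    _ = _ := by
      rw [Finset.mul_sum]
      exact Finset.sum_congr rfl fun y _ => by rw [hfac]; ring

lemma main_ind {P : (Fin ℓ → Ω) → ℝ} {π : Ω → ℝ} (hP : IsDist P) (hm : HasMarginals P π)
    (hπ : ∀ a, 0 ≤ π a) (h1 : ∑ a, π a = 1) {ρ δ η s : ℝ} (hρ : rho P ≤ ρ) (hρ1 : ρ < 1)
    (hδ : 0 < δ) (hδ1 : δ ≤ 1) (hη0 : 0 ≤ η) (hη1 : η ≤ 1) (hs : s = ℓ / (1 - ρ^2)) {n : ℕ}
    (g : Fin ℓ → (Fin n → Ω) → ℝ) (hg : ∀ j v, g j v ∈ Set.Icc δ 1) :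
    ∏ j, (exps π (g j)) ^ s - K1 ℓ δ s * ℓ^2 / δ^3 * ∑ j, Err π (2 + η) n (g j)
      ≤ exps P (fun x : Fin n → Fin ℓ → Ω => ∏ j, (g j (fun i => x i j)) ^ s) := by
  induction n with
  | zero =>
    rw [exps_zero _ _ (fun i => i.elim0)]
    simp only [Err, Finset.sum_const_zero, mul_zero, sub_zero]
    apply le_of_eq
    refine Finset.prod_congr rfl fun j _ => ?_
    rw [exps_zero]
  | succ n ih =>
    have ih' := ih (fun j => avg π (g j)) (fun j v => avg_bounds hπ h1 (g j) (hg j) v)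
    set K := K1 ℓ δ s * ℓ^2 / δ^3 with hK
    have e1 : exps P (fun x : Fin (n+1) → Fin ℓ → Ω => ∏ j, (g j (fun i => x i j)) ^ s)
        = exps P (fun x : Fin n → Fin ℓ → Ω =>
            ∑ y, P y * ∏ j, (g j (Fin.cons (y j) (fun i => x i j))) ^ s) := by
      rw [exps_succ, ← exps_wsum]
      simp only [cons_proj]
    rw [e1]
    have e2 : exps P (fun x : Fin n → Fin ℓ → Ω => ∏ j, (avg π (g j) (fun i => x i j)) ^ s
          - K * ∑ j, ∑ b, π b * |g j (Fin.cons b (fun i => x i j)) -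
            avg π (g j) (fun i => x i j)| ^ (2 + η))
        ≤ exps P (fun x : Fin n → Fin ℓ → Ω =>
            ∑ y, P y * ∏ j, (g j (Fin.cons (y j) (fun i => x i j))) ^ s) :=
      exps_mono hP.1 fun x => local_ineq hP hm hπ h1 hρ hρ1 hδ hδ1 hη0 hη1 hs
        (fun j b => g j (Fin.cons b (fun i => x i j))) (fun j b => hg j _)
        (fun j => avg π (g j) (fun i => x i j)) (fun j => rfl)
    refine le_trans ?_ e2
    rw [exps_sub, exps_smul, exps_sum]
    have e3 : ∀ j, exps P (fun x : Fin n → Fin ℓ → Ω => ∑ b, π b *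
        |g j (Fin.cons b (fun i => x i j)) - avg π (g j) (fun i => x i j)| ^ (2 + η))
        = ∑ b, π b * exps π (fun v => |g j (Fin.cons b v) - avg π (g j) v| ^ (2 + η)) := by
      intro j
      rw [exps_marg hm j (fun v => ∑ b, π b * |g j (Fin.cons b v) - avg π (g j) v| ^ (2 + η)),
        exps_wsum]
    simp only [e3]
    simp only [Err, Finset.sum_add_distrib, mul_add]
    simp only [exps_avg] at ih'
    linarith

end Local

/-! ### Final assembly -/

section Final

variable {Ω : Type} [Fintype Ω] {ℓ : ℕ}

lemma influence_affine {π : Ω → ℝ} (h1 : ∑ a, π a = 1) {n : ℕ} (i : Fin n)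
    (f : (Fin n → Ω) → ℝ) (c d : ℝ) :
    influence π i (fun v => c * f v + d) = c^2 * influence π i f := by
  have e : ∀ u : Ω → ℝ, varPi π (fun a => c * u a + d) = c^2 * varPi π u := by
    intro u
    have e1 : expPi π (fun a => c * u a + d) = c * expPi π u + d := by
      unfold expPi
      have : ∀ a, π a * (c * u a + d) = c * (π a * u a) + d * π a := fun a => by ring
      simp only [this, Finset.sum_add_distrib, ← Finset.mul_sum, h1, mul_one]
    unfold varPi
    rw [e1]
    generalize expPi π u = m
    unfold expPi
    rw [Finset.mul_sum]
    exact Finset.sum_congr rfl fun a _ => by ring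
  unfold influence
  rw [Finset.mul_sum]
  refine Finset.sum_congr rfl fun v _ => ?_
  rw [e (fun a => f (Function.update v i a))]
  ring

lemma influence_subsingleton {π : Ω → ℝ} (h1 : ∑ a, π a = 1) {n : ℕ} (i : Fin n)
    (f : (Fin n → Ω) → ℝ) (hΩ : ∀ a b : Ω, a = b) : influence π i f = 0 := by
  have hs : Subsingleton (Fin n → Ω) := ⟨fun x y => funext fun i => hΩ _ _⟩
  unfold influence
  refine Finset.sum_eq_zero fun v _ => ?_
  have : (fun a => f (Function.update v i a)) = fun _ => f v := by
    funext a
    rw [Subsingleton.elim (Function.update v i a) v]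
  rw [this]
  have e : expPi π (fun _ => f v) = f v := by
    unfold expPi
    rw [← Finset.sum_mul, h1, one_mul]
  unfold varPi
  rw [e]
  simp [expPi]

lemma prod_perturb {ι : Type} (s : Finset ι) (f g : ι → ℝ) {δ : ℝ} (hδ : 0 ≤ δ)
    (hf : ∀ j, f j ∈ Set.Icc (0:ℝ) 1) (hg : ∀ j, g j ∈ Set.Icc (0:ℝ) 1)
    (h : ∀ j, g j ≤ f j + δ) : ∏ j ∈ s, g j ≤ ∏ j ∈ s, f j + s.card * δ := by
  classical
  induction s using Finset.induction_on with
  | empty => simp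
  | insert k s hk ih =>
    rw [Finset.prod_insert hk, Finset.prod_insert hk, Finset.card_insert_of_notMem hk]
    have p0 : 0 ≤ ∏ j ∈ s, f j := Finset.prod_nonneg fun j _ => (hf j).1
    have p1 : ∏ j ∈ s, f j ≤ 1 := Finset.prod_le_one (fun j _ => (hf j).1) fun j _ => (hf j).2
    have q0 : 0 ≤ (s.card : ℝ) * δ := by positivity
    have a1 := mul_le_mul_of_nonneg_left ih (hg k).1
    have a2 := mul_le_mul_of_nonneg_right (h k) p0
    have a3 := mul_le_mul_of_nonneg_right (hg k).2 q0
    have a4 := mul_le_mul_of_nonneg_left p1 hδ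
    push_cast
    nlinarith

lemma core {P : (Fin ℓ → Ω) → ℝ} {π : Ω → ℝ} (hP : IsDist P) (hm : HasMarginals P π)
    (hπ : ∀ a, 0 < π a) (h1 : ∑ a, π a = 1) {ρ δ η γ L τ ε s : ℝ} (hρ : rho P ≤ ρ)
    (hρ1 : ρ < 1) (hδ : 0 < δ) (hδ1 : δ ≤ 1) (hη0 : 0 < η) (hη1 : η ≤ 1)
    (hγ0 : 0 ≤ γ) (hγ1 : γ ≤ 1)
    (hs : s = ℓ / (1 - ρ^2)) (hs1 : 1 ≤ s)
    (hα : ∀ a, Real.exp (-L) ≤ π a) (hL : 1/2 ≤ L) (hηL : 20 * η * L ≤ 1 - (1 - γ)^2)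
    (hδε : ℓ * δ ≤ ε / 4) (hγε : ℓ * (γ / (1 - ρ)) ≤ ε / 4)
    (hτ0 : 0 ≤ τ)
    (hK : K1 ℓ δ s * ℓ^2 / δ^3 * (ℓ * τ ^ (η/2)) ≤ ε / 4) (hε : 0 ≤ ε) {n : ℕ}
    (f : Fin ℓ → ((Fin n → Ω) → ℝ)) (hf : ∀ j v, f j v ∈ Set.Icc (0:ℝ) 1)
    (hinf : ∀ i j, influence π i (f j) ≤ τ) :
    (∏ j, exps π (f j)) ^ s - ε ≤ prodExp P f := by
  have hπ' := fun a => (hπ a).le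
  rw [prodExp_eq]
  have hs0 : 0 ≤ s := by linarith
  set f' : Fin ℓ → ((Fin n → Ω) → ℝ) := fun j v => (1 - δ) * f j v + δ with hf'
  have hb : ∀ j v, f' j v ∈ Set.Icc δ 1 := by
    intro j v
    have := hf j v
    simp only [hf']
    constructor <;> nlinarith [this.1, this.2]
  have hb0 : ∀ j v, f' j v ∈ Set.Icc (0:ℝ) 1 := fun j v => ⟨hδ.le.trans (hb j v).1, (hb j v).2⟩
  have st1 : exps P (fun x : Fin n → Fin ℓ → Ω => ∏ j, f' j (fun i => x i j)) ≤
      exps P (fun x : Fin n → Fin ℓ → Ω => ∏ j, f j (fun i => x i j)) + ε / 4 := by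
    have h2 : exps P (fun x : Fin n → Fin ℓ → Ω => ∏ j, f' j (fun i => x i j)) ≤
        exps P (fun x : Fin n → Fin ℓ → Ω => ∏ j, f j (fun i => x i j) + ℓ * δ) := by
      refine exps_mono hP.1 fun x => ?_
      have := prod_perturb Finset.univ (fun j => f j (fun i => x i j))
        (fun j => f' j (fun i => x i j)) hδ.le (fun j => hf j _) (fun j => hb0 j _)
        (fun j => by
          have := hf j (fun i => x i j)
          simp only [hf']
          nlinarith [this.1, this.2])
      simpa using this
    rw [exps_add, exps_const hP.2] at h2
    linarith
  have st2 := smooth_err hP hm hπ' h1 hρ hρ1 hγ0 hγ1 f' hb0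
  have hTb : ∀ j v, T π (1 - γ) (f' j) v ∈ Set.Icc δ 1 := fun j v =>
    T_bounds hπ' h1 (by linarith) (by linarith) (f' j) (hb j) v
  have st3 : exps P (fun x : Fin n → Fin ℓ → Ω => ∏ j, (T π (1 - γ) (f' j) (fun i => x i j)) ^ s)
      ≤ exps P (fun x : Fin n → Fin ℓ → Ω => ∏ j, T π (1 - γ) (f' j) (fun i => x i j)) := by
    refine exps_mono hP.1 fun x => Finset.prod_le_prod (fun j _ => ?_) fun j _ => ?_
    · exact Real.rpow_nonneg (hδ.le.trans (hTb j _).1) _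
    · calc _ ≤ (T π (1 - γ) (f' j) (fun i => x i j)) ^ (1:ℝ) :=
            Real.rpow_le_rpow_of_exponent_ge (hδ.trans_le (hTb j _).1) (hTb j _).2 hs1
        _ = _ := Real.rpow_one _
  have st4 := main_ind hP hm hπ' h1 hρ hρ1 hδ hδ1 hη0.le hη1 hs
    (fun j => T π (1 - γ) (f' j)) hTb
  have hErr : ∀ j, Err π (2 + η) n (T π (1 - γ) (f' j)) ≤ τ ^ (η/2) := by
    intro j
    have hinf' : ∀ i, influence π i (f' j) ≤ τ := by
      intro i
      have e := influence_affine h1 i (f j) (1 - δ) δ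
      have e' : influence π i (f' j) = (1 - δ)^2 * influence π i (f j) := e
      rw [e']
      have h0 := influence_nonneg hπ' i (f j)
      have : (1 - δ)^2 ≤ 1 := by nlinarith
      nlinarith [hinf i j]
    refine (err_bound hπ h1 hα hL (by linarith) (by linarith) hη0 hη1 hηL (f' j) hinf').trans ?_
    have : exps π (fun v => f' j v ^ 2) ≤ 1 := by
      refine le_trans (exps_mono hπ' (g := fun _ => 1) (fun x => ?_)) (exps_const h1 1).le
      have := hb0 j x
      nlinarith [this.1, this.2]
    have h0 := Real.rpow_nonneg hτ0 (η/2)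
    nlinarith
  have hErrS : ∑ j, Err π (2 + η) n (T π (1 - γ) (f' j)) ≤ ℓ * τ ^ (η/2) := by
    calc _ ≤ ∑ j : Fin ℓ, τ ^ (η/2) := Finset.sum_le_sum fun j _ => hErr j
      _ = _ := by simp
  have hK0 := K1_nonneg ℓ hδ hs0
  have hKE := mul_le_mul_of_nonneg_left hErrS
    (show 0 ≤ K1 ℓ δ s * ℓ^2 / δ^3 by positivity)
  have st5 : (∏ j, exps π (f j)) ^ s ≤ ∏ j, (exps π (T π (1 - γ) (f' j))) ^ s := by
    have h0 : ∀ j, 0 ≤ exps π (f j) := fun j => exps_nonneg hπ' fun v => (hf j v).1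
    rw [← Real.finsetProd_rpow _ _ (fun j _ => h0 j)]
    refine Finset.prod_le_prod (fun j _ => Real.rpow_nonneg (h0 j) _) fun j _ => ?_
    refine Real.rpow_le_rpow (h0 j) ?_ hs0
    rw [exps_T h1]
    refine exps_mono hπ' fun v => ?_
    have := hf j v
    simp only [hf']
    nlinarith [this.1, this.2]
  linarith

end Final

lemma K1_bound {ℓ : ℕ} {δ s b : ℝ} (hb : 8 ≤ b) (hδ : 0 < δ) (hs0 : 0 ≤ s) (hs : s ≤ b)
    (hℓ : (ℓ:ℝ) ≤ b) (hD : 1 / δ ≤ b^2) :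
    K1 ℓ δ s * ℓ^2 / δ^3 ≤ b^42 := by
  have hb0 : 0 ≤ b := by linarith
  have hb1 : 1 ≤ b := by linarith
  have hD0 : 0 ≤ 1/δ := by positivity
  have hℓ0 : (0:ℝ) ≤ ℓ := by positivity
  set D := 1/δ with hDd
  have hM : (ℓ:ℝ) / δ = ℓ * D := by rw [hDd]; ring
  have hM1 : (ℓ:ℝ) * D ≤ b^3 := by
    calc (ℓ:ℝ) * D ≤ b * b^2 := mul_le_mul hℓ hD hD0 hb0
      _ = _ := by ring
  have hM2 : (ℓ:ℝ) * D / δ ≤ b^5 := by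
    calc (ℓ:ℝ) * D / δ = (ℓ * D) * D := by rw [hDd]; ring
      _ ≤ b^3 * b^2 := mul_le_mul hM1 hD hD0 (by positivity)
      _ = _ := by ring
  have hH : 1 + (ℓ:ℝ) * D / δ ≤ b^6 := by
    have : 1 ≤ b^5 := one_le_pow₀ hb1
    have e : b^6 = b * b^5 := by ring
    nlinarith
  have hH0 : 0 ≤ 1 + (ℓ:ℝ) * D / δ := by positivity
  have hHM : 1 + (1 + (ℓ:ℝ) * D / δ) * (ℓ * D) ≤ b^10 := by
    have h2 : (1 + (ℓ:ℝ) * D / δ) * (ℓ * D) ≤ b^6 * b^3 :=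
      mul_le_mul hH hM1 (by positivity) (by positivity)
    have : 1 ≤ b^9 := one_le_pow₀ hb1
    have e : b^10 = b * b^9 := by ring
    nlinarith
  have hK : K1 ℓ δ s ≤ b^34 := by
    unfold K1
    rw [hM]
    have a1 : s / δ ≤ b^33 := by
      calc s / δ = s * D := by rw [hDd]; ring
        _ ≤ b * b^2 := mul_le_mul hs hD hD0 hb0
        _ = b^3 := by ring
        _ ≤ b^33 := pow_le_pow_right₀ hb1 (by norm_num)
    have a2 : s^2 * (1 + (ℓ:ℝ) * D / δ) ≤ b^33 := by
      calc _ ≤ b^2 * b^6 := mul_le_mul (pow_le_pow_left₀ hs0 hs 2) hH hH0 (by positivity)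
        _ = b^8 := by ring
        _ ≤ b^33 := pow_le_pow_right₀ hb1 (by norm_num)
    have a3 : s^3 * (1 + (1 + (ℓ:ℝ) * D / δ) * (ℓ * D))^3 ≤ b^33 := by
      calc _ ≤ b^3 * (b^10)^3 := mul_le_mul (pow_le_pow_left₀ hs0 hs 3)
            (pow_le_pow_left₀ (by positivity) hHM 3) (by positivity) (by positivity)
        _ = b^33 := by ring
    have : 0 ≤ b^33 := by positivity
    have e : b^34 = b * b^33 := by ring
    nlinarith
  have hK0 := K1_nonneg ℓ hδ hs0
  calc K1 ℓ δ s * ℓ^2 / δ^3 = K1 ℓ δ s * (ℓ^2 * D^3) := by rw [hDd]; field_simp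
    _ ≤ b^34 * (b^2 * (b^2)^3) := by
      apply mul_le_mul hK _ (by positivity) (by positivity)
      exact mul_le_mul (pow_le_pow_left₀ hℓ0 hℓ 2) (pow_le_pow_left₀ hD0 hD 3) (by positivity)
        (by positivity)
    _ = b^42 := by ring

lemma num_bound {ℓ : ℕ} {ρ ε κ : ℝ} (hℓ : 2 ≤ ℓ) (hρ0 : 0 ≤ ρ) (hρ1 : ρ < 1) (hε0 : 0 < ε)
    (hε1 : ε ≤ 1/2) (hκ : 57 ≤ κ) :
    0 < (1 - ρ^2) * ε / (ℓ : ℝ) ^ ((5:ℝ)/2) ∧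
    K1 ℓ (ε / (4 * ℓ)) (ℓ / (1 - ρ^2)) * ℓ^2 / (ε / (4 * ℓ))^3 *
      (ℓ * ((1 - ρ^2) * ε / (ℓ : ℝ) ^ ((5:ℝ)/2)) ^ κ) ≤ ε / 4 := by
  have hl : (2:ℝ) ≤ ℓ := by exact_mod_cast hℓ
  have hq0 : 0 < 1 - ρ^2 := by nlinarith
  have hq1 : 1 - ρ^2 ≤ 1 := by nlinarith
  set q := 1 - ρ^2 with hq
  set X := (ℓ : ℝ) ^ ((5:ℝ)/2) with hX
  have hX2 : (ℓ:ℝ)^2 ≤ X := by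
    rw [hX, ← Real.rpow_natCast]
    exact Real.rpow_le_rpow_of_exponent_le (by linarith) (by norm_num)
  have hX0 : 0 < X := by nlinarith
  have hβ0 : 0 < q * ε / X := by positivity
  refine ⟨hβ0, ?_⟩
  set β := q * ε / X with hβ
  set b := β⁻¹ with hb
  have hbv : b = X / (q * ε) := by rw [hb, hβ, inv_div]
  have hbe : 4 / ε ≤ b := by
    rw [hbv, div_le_div_iff₀ hε0 (by positivity)]
    have h1 : 4 ≤ X := by nlinarith
    have h2 : q * ε ≤ 1 * ε := mul_le_mul_of_nonneg_right hq1 hε0.le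
    nlinarith
  have hb8 : 8 ≤ b := by
    refine le_trans ?_ hbe
    rw [le_div_iff₀ hε0]; linarith
  have hbs : ℓ / q ≤ b := by
    rw [hbv, div_le_div_iff₀ hq0 (by positivity)]
    have h1 : (ℓ:ℝ) * ε ≤ X := by nlinarith
    nlinarith
  have hbl : (ℓ:ℝ) ≤ b := by
    refine le_trans ?_ hbs
    rw [le_div_iff₀ hq0]; nlinarith
  have hD : 1 / (ε / (4 * ℓ)) ≤ b^2 := by
    have e : 1 / (ε / (4 * ℓ)) = (4/ε) * ℓ := by field_simp
    rw [e, sq]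
    exact mul_le_mul hbe hbl (by positivity) (by linarith)
  have hKb := K1_bound hb8 (show 0 < ε / (4 * ℓ) by positivity) (show 0 ≤ ℓ / q by positivity)
    hbs hbl hD
  have hβ1 : β ≤ 1 := by
    have : β * b = 1 := mul_inv_cancel₀ hβ0.ne'
    nlinarith
  have hpow : β ^ κ ≤ β ^ (57:ℕ) := by
    rw [← Real.rpow_natCast]
    exact Real.rpow_le_rpow_of_exponent_ge hβ0 hβ1 (by push_cast; exact hκ)
  have hbeb : β ≤ ε / 4 := by
    have h1 : β * b = 1 := mul_inv_cancel₀ hβ0.ne'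
    have h2 : β * (4/ε) ≤ 1 := by rw [← h1]; exact mul_le_mul_of_nonneg_left hbe hβ0.le
    rw [mul_div_assoc', div_le_one hε0] at h2
    linarith
  calc _ ≤ b^42 * (b * β^57) := by
        apply mul_le_mul hKb _ (by positivity) (by positivity)
        exact mul_le_mul hbl hpow (by positivity) (by linarith)
    _ = (b * β)^43 * β^14 := by ring
    _ = β^14 := by rw [hb, inv_mul_cancel₀ hβ0.ne', one_pow, one_mul]
    _ ≤ β^1 := pow_le_pow_of_le_one hβ0.le hβ1 (by norm_num)
    _ = β := pow_one _
    _ ≤ _ := hbeb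

/-- the low-influence set hitting theorem with an explicit
influence threshold `τ`. -/
theorem low_influence_set_hitting :
    ∃ C : ℝ, 0 ≤ C ∧
      ∀ (Ω : Type) [Fintype Ω],
      ∀ ℓ : ℕ, 2 ≤ ℓ →
      ∀ (P : (Fin ℓ → Ω) → ℝ) (π : Ω → ℝ) (ρ α : ℝ),
        IsDist P → HasMarginals P π → (∀ a : Ω, 0 < π a) →
        rho P ≤ ρ → ρ < 1 → 0 < α → (∀ a : Ω, α ≤ π a) →
      ∀ ε : ℝ, ε ∈ Set.Ioc (0:ℝ) (1/2) →
      ∀ n : ℕ, 1 ≤ n →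
      ∀ f : Fin ℓ → ((Fin n → Ω) → ℝ),
        (∀ j v, f j v ∈ Set.Icc (0:ℝ) 1) →
        (∀ (i : Fin n) (j : Fin ℓ),
          influence π i (f j) ≤
            ((1 - ρ^2) * ε / (ℓ : ℝ) ^ ((5:ℝ)/2)) ^
              (C * ℓ * Real.log (ℓ / ε) * Real.log (1/α) / ((1 - ρ) * ε))) →
        (∏ j, exps π (f j)) ^ ((ℓ : ℝ) / (1 - ρ^2)) - ε ≤ prodExp P f := by
  refine ⟨10000, by norm_num, ?_⟩
  intro Ω _ ℓ hℓ P π ρ α hP hm hπ hρ hρ1 hα0 hα ε hε n hn f hf hinf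
  obtain ⟨hε0, hε1⟩ := hε
  have hl : (2:ℝ) ≤ ℓ := by exact_mod_cast hℓ
  have hρ0 : 0 ≤ ρ := (rho_nonneg hP).trans hρ
  have hq0 : 0 < 1 - ρ^2 := by nlinarith
  have hq1 : 1 - ρ^2 ≤ 1 := by nlinarith
  have h1 : ∑ a, π a = 1 := by
    have := marg_sum hm ⟨0, by omega⟩ (fun _ => 1)
    simp only [mul_one] at this
    rw [← this]; exact hP.2
  set α' := min α (1/2) with hα'
  have hα'0 : 0 < α' := lt_min hα0 (by norm_num)
  have hα'1 : α' ≤ 1/2 := min_le_right _ _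
  set L := Real.log (1/α') with hLd
  have hL : 1/2 ≤ L := by
    have h2 : Real.log 2 ≤ L := by
      apply Real.log_le_log (by norm_num)
      rw [le_div_iff₀ hα'0]; linarith
    have := Real.log_two_gt_d9
    linarith
  have hL0 : 0 < L := by linarith
  have hexp : Real.exp (-L) = α' := by
    rw [hLd, one_div, Real.log_inv, neg_neg, Real.exp_log hα'0]
  set γ := (1 - ρ) * ε / (4 * ℓ) with hγ
  have hγ0 : 0 < γ := by
    have : 0 < 1 - ρ := by linarith
    positivity
  have hγ1 : γ ≤ 1 := by
    rw [hγ, div_le_one (by linarith)]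
    nlinarith
  set η := γ / (20 * L) with hη
  have hη0 : 0 < η := by positivity
  have hη1 : η ≤ 1 := by
    rw [hη, div_le_one (by linarith)]; linarith
  have hΛ : 1 ≤ Real.log (ℓ / ε) := by
    have h2 : Real.log 4 ≤ Real.log (ℓ / ε) := by
      apply Real.log_le_log (by norm_num)
      rw [le_div_iff₀ hε0]; linarith
    have h3 : Real.log 4 = 2 * Real.log 2 := by
      rw [show (4:ℝ) = 2^2 by norm_num, Real.log_pow]; norm_num
    have := Real.log_two_gt_d9
    linarith
  set β := (1 - ρ^2) * ε / (ℓ : ℝ) ^ ((5:ℝ)/2) with hβ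
  set κ := 10000 * Real.log (ℓ / ε) / 160 with hκ
  obtain ⟨hβ0, hnum⟩ := num_bound (κ := κ) hℓ hρ0 hρ1 hε0 hε1 (by rw [hκ]; linarith)
  set E := 10000 * ℓ * Real.log (ℓ / ε) * L / ((1 - ρ) * ε) with hE
  have hEη : E * (η / 2) = κ := by
    have : 1 - ρ ≠ 0 := by linarith
    rw [hE, hη, hκ, hγ]
    field_simp
    norm_num
  refine core (δ := ε / (4 * ℓ)) (η := η) (γ := γ) (L := L) (τ := β ^ E) hP hm hπ h1 hρ hρ1
    (by positivity) ?_ hη0 hη1 hγ0.le hγ1 rfl ?_ ?_ hL ?_ ?_ ?_ ?_ ?_ hε0.le f hf ?_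
  · rw [div_le_one (by linarith)]; linarith
  · rw [le_div_iff₀ hq0]; linarith
  · intro a
    rw [hexp]
    exact (min_le_left _ _).trans (hα a)
  · have e : 20 * η * L = γ := by rw [hη]; field_simp
    rw [e]; nlinarith
  · apply le_of_eq; field_simp
  · have : 1 - ρ ≠ 0 := by linarith
    apply le_of_eq; rw [hγ]; field_simp
  · exact Real.rpow_nonneg hβ0.le _
  · rw [← Real.rpow_mul hβ0.le, hEη]
    exact hnum
  · intro i j
    rcases le_or_gt α (1/2) with h | h
    · have e : α' = α := min_eq_left h
      have := hinf i j
      rw [hE, hLd, e]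
      exact this
    · rw [influence_subsingleton h1 i (f j)]
      · exact Real.rpow_nonneg hβ0.le _
      · intro a b
        by_contra hab
        have h3 : π a + π b ≤ ∑ a, π a := by
          classical
          rw [← Finset.sum_pair hab]
          exact Finset.sum_le_sum_of_subset_of_nonneg (Finset.subset_univ _)
            fun c _ _ => (hπ c).le
        linarith [hα a, hα b]

end SameSetHitting
end

section
/- Let P be the three-step distribution on {0,1,2}³ that is uniform on the six triples {(0,0,0),(1,1,1),(2,2,2),(0,1,2),(1,2,0),(2,0,1)}. Then for every ε > 0 there exists n₀ such that for every n > n₀ there exist sets S^{(1)}, S^{(2)}, S^{(3)} ⊆ {0,1,2}ⁿ satisfying: (i) Pr[X^{(j)} ∈ S^{(j)}] ≥ 0.49 for each j ∈ {1,2,3}; (ii) Pr[X^{(1)} ∈ S^{(1)} and X^{(2)} ∈ S^{(2)} and X^{(3)} ∈ S^{(3)}] = 0; (iii) max_{i∈[n]} Inf_i(1_{S^{(j)}}(X^{(j)})) ≤ ε for each j ∈ {1,2,3}. -/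
namespace SameSetHitting

open Classical in
/-- The uniform distribution on `{000, 111, 222, 012, 120, 201} ⊆ {0,1,2}³`. -/
noncomputable def P3 : (Fin 3 → Fin 3) → ℝ := fun x =>
  if x = ![0,0,0] ∨ x = ![1,1,1] ∨ x = ![2,2,2] ∨
     x = ![0,1,2] ∨ x = ![1,2,0] ∨ x = ![2,0,1]
  then 1/6 else 0


/-- Law of the simple lazy walk. -/
noncomputable def walk : ℕ → ℤ → ℝ
  | 0, s => if s = 0 then 1 else 0
  | n + 1, s => (walk n (s - 1) + walk n s + walk n (s + 1)) / 3

lemma walk_nonneg (n : ℕ) (s : ℤ) : 0 ≤ walk n s := by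
  induction n generalizing s with
  | zero => simp only [walk]; split_ifs <;> norm_num
  | succ n ih =>
    simp only [walk]
    have := ih (s - 1); have := ih s; have := ih (s + 1)
    positivity

lemma walk_neg (n : ℕ) (s : ℤ) : walk n (-s) = walk n s := by
  induction n generalizing s with
  | zero => simp [walk]
  | succ n ih =>
    simp only [walk]
    rw [show -s - 1 = -(s + 1) by ring, show -s + 1 = -(s - 1) by ring, ih, ih, ih]
    ring

lemma walk_step (n : ℕ) (s : ℤ) (hs : 0 ≤ s) : walk n (s + 1) ≤ walk n s := by
  induction n generalizing s with
  | zero =>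
    simp only [walk]
    rw [if_neg (by omega)]
    split_ifs <;> norm_num
  | succ n ih =>
    simp only [walk]
    have key : walk n (s + 1 + 1) ≤ walk n (s - 1) := by
      rcases eq_or_lt_of_le hs with h | h
      · subst h
        have h1 := ih 1 (by norm_num)
        have h2 := walk_neg n 1
        norm_num at h1 h2 ⊢
        linarith
      · have h0 := ih (s - 1) (by omega)
        have h1 := ih s hs
        have h2 := ih (s + 1) (by omega)
        rw [sub_add_cancel] at h0
        linarith
    rw [show s + 1 - 1 = s by ring]
    linarith

lemma walk_le_nat (n k : ℕ) : walk n (k : ℤ) ≤ walk n 0 := by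
  induction k with
  | zero => simp
  | succ k ih =>
    push_cast
    exact (walk_step n k (by positivity)).trans ih

lemma walk_le (n : ℕ) (s : ℤ) : walk n s ≤ walk n 0 := by
  obtain ⟨k, rfl | rfl⟩ := s.eq_nat_or_neg
  · exact walk_le_nat n k
  · rw [walk_neg]; exact walk_le_nat n k

lemma walk_hasSum (n : ℕ) : HasSum (walk n) 1 := by
  induction n with
  | zero => exact hasSum_ite_eq 0 1
  | succ n ih =>
    have h1 : HasSum (fun s => walk n (s - 1)) 1 := (Equiv.subRight (1 : ℤ)).hasSum_iff.2 ih
    have h2 : HasSum (fun s => walk n (s + 1)) 1 := (Equiv.addRight (1 : ℤ)).hasSum_iff.2 ih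
    have := ((h1.add ih).add h2).div_const 3
    norm_num at this
    exact this

open Filter Topology in
lemma walk_tendsto : Tendsto (fun n => walk n 0) atTop (𝓝 0) := by
  have hanti : Antitone (fun n => walk n 0) := by
    apply antitone_nat_of_succ_le
    intro n
    have h : walk (n + 1) 0 = (walk n (0 - 1) + walk n 0 + walk n (0 + 1)) / 3 := rfl
    have h1 := walk_le n (0 - 1)
    have h2 := walk_le n (0 + 1)
    change walk (n + 1) 0 ≤ walk n 0
    rw [h]
    generalize walk n (0 - 1) = a at *
    generalize walk n (0 + 1) = b at *
    linarith only [h1, h2]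
  have hbdd : BddBelow (Set.range (fun n => walk n 0)) :=
    ⟨0, by rintro _ ⟨n, rfl⟩; exact walk_nonneg n 0⟩
  obtain ⟨L, hL⟩ : ∃ L, Tendsto (fun n => walk n 0) atTop (𝓝 L) :=
    ⟨_, tendsto_atTop_ciInf hanti hbdd⟩
  have hstep : ∀ s : ℤ, ∀ n, walk n (s + 1) = 3 * walk (n + 1) s - walk n s - walk n (s - 1) := by
    intro s n; simp only [walk]; ring
  have hk : ∀ k : ℕ, Tendsto (fun n => walk n (k : ℤ)) atTop (𝓝 L) ∧
      Tendsto (fun n => walk n ((k : ℤ) + 1)) atTop (𝓝 L) := by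
    intro k
    induction k with
    | zero =>
      refine ⟨by simpa using hL, ?_⟩
      have h : ∀ n, walk n ((0 : ℕ) + 1 : ℤ) = (3 * walk (n + 1) 0 - walk n 0) / 2 := by
        intro n
        have := hstep 0 n
        have h2 := walk_neg n 1
        norm_num at this h2 ⊢
        linarith
      simp_rw [h]
      have h3 := ((((tendsto_add_atTop_iff_nat 1).2 hL).const_mul 3).sub hL).div_const 2
      convert h3 using 2
      ring
    | succ k ih =>
      obtain ⟨i1, i2⟩ := ih
      push_cast
      refine ⟨i2, ?_⟩
      simp_rw [hstep ((k : ℤ) + 1), add_sub_cancel_right]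
      have h3 := ((((tendsto_add_atTop_iff_nat 1).2 i2).const_mul 3).sub i2).sub i1
      convert h3 using 2
      ring
  have hle : ∀ K : ℕ, K * L ≤ 1 := by
    intro K
    have hT : Tendsto (fun n => ∑ k ∈ Finset.range K, walk n (k : ℤ)) atTop
        (𝓝 (∑ k ∈ Finset.range K, L)) := tendsto_finsetSum _ (fun k _ => (hk k).1)
    simp only [Finset.sum_const, Finset.card_range, nsmul_eq_mul] at hT
    refine le_of_tendsto hT (Eventually.of_forall fun n => ?_)
    have := sum_le_hasSum ((Finset.range K).map ⟨((↑) : ℕ → ℤ), Nat.cast_injective⟩)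
      (fun s _ => walk_nonneg n s) (walk_hasSum n)
    simpa using this
  have hL0 : 0 ≤ L := ge_of_tendsto' hL (fun n => walk_nonneg n 0)
  have : L = 0 := by
    by_contra hne
    have hpos : 0 < L := lt_of_le_of_ne hL0 (Ne.symm hne)
    obtain ⟨K, hK⟩ := exists_nat_gt (1 / L)
    rw [div_lt_iff₀ hpos] at hK
    linarith [hle K]
  rwa [this] at hL

/-- The weights. -/
def wt (j a : Fin 3) : ℤ := ![1, -1, 0] (a + j)

/-- The linear form. -/
def tot {n : ℕ} (j : Fin 3) (v : Fin n → Fin 3) : ℤ := ∑ i, wt j (v i)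

lemma law (j : Fin 3) (n : ℕ) (s : ℤ) :
    ∑ v : Fin n → Fin 3, (1 / 3 : ℝ) ^ n * (if tot j v = s then 1 else 0) = walk n s := by
  induction n generalizing s with
  | zero => simp [tot, walk, eq_comm]
  | succ n ih =>
    rw [← (Fin.consEquiv (fun _ => Fin 3)).sum_comp, Fintype.sum_prod_type]
    have h : ∀ (a : Fin 3), ∑ v : Fin n → Fin 3, (1 / 3 : ℝ) ^ (n + 1) *
        (if tot j ((Fin.consEquiv (fun _ : Fin (n + 1) => Fin 3)) (a, v)) = s then 1 else 0)
        = walk n (s - wt j a) / 3 := by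
      intro a
      rw [← ih, Finset.sum_div]
      refine Finset.sum_congr rfl fun v _ => ?_
      have : (tot j ((Fin.consEquiv (fun _ : Fin (n + 1) => Fin 3)) (a, v)) = s) ↔
          tot j v = s - wt j a := by
        simp only [tot, Fin.consEquiv, Equiv.coe_fn_mk, Fin.sum_univ_succ, Fin.cons_zero,
          Fin.cons_succ]
        constructor <;> intro h <;> linarith
      simp only [this]
      ring
    simp only [h, walk]
    fin_cases j <;> simp [Fin.sum_univ_three, wt] <;> ring

lemma marg (j a : Fin 3) : marginal P3 j a = 1 / 3 := by
  classical
  have h : ∀ x, P3 x = if x ∈ ({![0,0,0], ![1,1,1], ![2,2,2], ![0,1,2], ![1,2,0], ![2,0,1]} :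
      Finset (Fin 3 → Fin 3)) then 1 / 6 else 0 := by
    intro x; simp [P3]
  have h2 : ∀ x, (if x j = a then P3 x else 0) =
      if x ∈ ({![0,0,0], ![1,1,1], ![2,2,2], ![0,1,2], ![1,2,0], ![2,0,1]} :
      Finset (Fin 3 → Fin 3)).filter (fun x => x j = a) then (1 / 6 : ℝ) else 0 := by
    intro x; rw [h]; simp only [Finset.mem_filter]; split_ifs <;> first | rfl | tauto
  simp only [marginal]
  have h3 : (({![0,0,0], ![1,1,1], ![2,2,2], ![0,1,2], ![1,2,0], ![2,0,1]} :
      Finset (Fin 3 → Fin 3)).filter (fun x => x j = a)).card = 2 := by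
    clear h h2; revert j a; decide
  calc _ = ∑ x, (if x ∈ ({![0,0,0], ![1,1,1], ![2,2,2], ![0,1,2], ![1,2,0], ![2,0,1]} :
      Finset (Fin 3 → Fin 3)).filter (fun x => x j = a) then (1 / 6 : ℝ) else 0) := by
        refine Finset.sum_congr rfl fun x _ => ?_
        rw [← h2]
        congr
    _ = 1 / 3 := by
      rw [Finset.sum_ite_mem, Finset.univ_inter, Finset.sum_const]
      rw [show ∀ A B : ℕ, A = 2 → A • (1 / 6 : ℝ) = 1 / 3 by intro A _ h; rw [h]; norm_num]
      · exact 0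
      · convert h3

lemma marginalize {n : ℕ} (j : Fin 3) (F : (Fin n → Fin 3) → ℝ) :
    ∑ x : Fin 3 → Fin n → Fin 3, (∏ i, P3 (fun j' => x j' i)) * F (x j) =
    ∑ v : Fin n → Fin 3, (1 / 3 : ℝ) ^ n * F v := by
  classical
  have h : ∀ v : Fin n → Fin 3, (1 / 3 : ℝ) ^ n =
      ∑ y : Fin n → Fin 3 → Fin 3, if (fun i => y i j) = v then ∏ i, P3 (y i) else 0 := by
    intro v
    calc (1 / 3 : ℝ) ^ n = ∏ i, marginal P3 j (v i) := by simp [marg]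
      _ = ∏ i, ∑ z : Fin 3 → Fin 3, (if z j = v i then P3 z else 0) := by
        refine Finset.prod_congr rfl fun i _ => ?_
        simp only [marginal]
        refine Finset.sum_congr rfl fun z _ => ?_
        congr
      _ = _ := by
        rw [Finset.prod_univ_sum, Fintype.piFinset_univ]
        refine Finset.sum_congr rfl fun y _ => ?_
        rw [Finset.prod_ite_zero]
        simp [funext_iff]
  calc _ = ∑ y : Fin n → Fin 3 → Fin 3, (∏ i, P3 (y i)) * F (fun i => y i j) :=
        (Equiv.sum_comp (Equiv.piComm (fun (_ : Fin 3) (_ : Fin n) => Fin 3))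
          (fun y => (∏ i, P3 (y i)) * F (fun i => y i j)))
    _ = ∑ y : Fin n → Fin 3 → Fin 3, ∑ v : Fin n → Fin 3,
          (if (fun i => y i j) = v then ∏ i, P3 (y i) else 0) * F v := by
        refine Finset.sum_congr rfl fun y _ => ?_
        simp
    _ = _ := by
        rw [Finset.sum_comm]
        refine Finset.sum_congr rfl fun v _ => ?_
        rw [h v, Finset.sum_mul]

lemma prob_pos (j : Fin 3) (n : ℕ) :
    ∑ v : Fin n → Fin 3, (1 / 3 : ℝ) ^ n * (if 0 < tot j v then 1 else 0)
      = (1 - walk n 0) / 2 := by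
  have hsym : ∑ v : Fin n → Fin 3, (1 / 3 : ℝ) ^ n * (if 0 < tot j v then 1 else 0) =
      ∑ v : Fin n → Fin 3, (1 / 3 : ℝ) ^ n * (if tot j v < 0 then 1 else 0) := by
    rw [← (Equiv.piCongrRight (fun _ : Fin n => Equiv.subLeft (1 + j))).sum_comp]
    refine Finset.sum_congr rfl fun v _ => ?_
    have hw : ∀ a, wt j (1 + j - a) = - wt j a := by revert j; decide
    have : tot j ((Equiv.piCongrRight (fun _ : Fin n => Equiv.subLeft (1 + j))) v) = - tot j v := by
      simp [tot, hw]
    simp [this]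
  have hone : ∑ v : Fin n → Fin 3, (1 / 3 : ℝ) ^ n = 1 := by
    simp
  have hsplit : ∑ v : Fin n → Fin 3, (1 / 3 : ℝ) ^ n =
      ∑ v : Fin n → Fin 3, (1 / 3 : ℝ) ^ n * (if 0 < tot j v then 1 else 0) +
      ∑ v : Fin n → Fin 3, (1 / 3 : ℝ) ^ n * (if tot j v = 0 then 1 else 0) +
      ∑ v : Fin n → Fin 3, (1 / 3 : ℝ) ^ n * (if tot j v < 0 then 1 else 0) := by
    rw [← Finset.sum_add_distrib, ← Finset.sum_add_distrib]
    refine Finset.sum_congr rfl fun v _ => ?_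
    rcases lt_trichotomy (tot j v) 0 with h | h | h
    · simp [h, h.ne, h.le]
    · simp [h]
    · simp [h, h.ne', h.le]
  rw [hone, law, ← hsym] at hsplit
  linarith

lemma tot_update {n : ℕ} (j : Fin 3) (v : Fin n → Fin 3) (i : Fin n) (a : Fin 3) :
    tot j (Function.update v i a) = tot j v - wt j (v i) + wt j a := by
  simp only [tot]
  rw [← Finset.add_sum_erase _ _ (Finset.mem_univ i), ← Finset.add_sum_erase
    _ (fun k => wt j (v k)) (Finset.mem_univ i)]
  have : ∑ x ∈ Finset.univ.erase i, wt j (Function.update v i a x) =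
      ∑ x ∈ Finset.univ.erase i, wt j (v x) := by
    refine Finset.sum_congr rfl fun x hx => ?_
    rw [Function.update_of_ne (Finset.ne_of_mem_erase hx)]
  rw [this, Function.update_self]; ring

lemma wt_bd (j a : Fin 3) : -1 ≤ wt j a ∧ wt j a ≤ 1 := by
  revert j a; decide

lemma var_third (f : Fin 3 → ℝ) (hf : ∀ a, f a = 0 ∨ f a = 1) :
    varPi (fun _ => 1 / 3) f ≤ 1 := by
  simp only [varPi, expPi, Fin.sum_univ_three]
  rcases hf 0 with h0 | h0 <;> rcases hf 1 with h1 | h1 <;> rcases hf 2 with h2 | h2 <;>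
    rw [h0, h1, h2] <;> norm_num

lemma var_const (c : ℝ) : varPi (fun _ : Fin 3 => (1 / 3 : ℝ)) (fun _ => c) = 0 := by
  simp only [varPi, expPi, Fin.sum_univ_three]
  ring

lemma infl (j : Fin 3) (n : ℕ) (i : Fin n) :
    influence (marginal P3 j) i (fun v => if 0 < tot j v then (1:ℝ) else 0) ≤ 4 * walk n 0 := by
  have hm : marginal P3 j = fun _ => 1 / 3 := funext (marg j)
  rw [hm]
  simp only [influence, Finset.prod_const, Finset.card_univ, Fintype.card_fin]
  calc _ ≤ ∑ v : Fin n → Fin 3, ((1 / 3 : ℝ) ^ n * (if tot j v = -1 then 1 else 0) +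
        (1 / 3 : ℝ) ^ n * (if tot j v = 0 then 1 else 0) +
        (1 / 3 : ℝ) ^ n * (if tot j v = 1 then 1 else 0) +
        (1 / 3 : ℝ) ^ n * (if tot j v = 2 then 1 else 0)) := by
        refine Finset.sum_le_sum fun v _ => ?_
        rw [← mul_add, ← mul_add, ← mul_add]
        refine mul_le_mul_of_nonneg_left ?_ (by positivity)
        simp only [tot_update]
        have hb := wt_bd j (v i)
        by_cases h1 : tot j v ≤ -2
        · have : ∀ a, ¬ (0 < tot j v - wt j (v i) + wt j a) := by
            intro a; have := wt_bd j a; omega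
          simp only [this, if_false]
          rw [var_const]; positivity
        · by_cases h2 : 3 ≤ tot j v
          · have : ∀ a, (0 < tot j v - wt j (v i) + wt j a) := by
              intro a; have := wt_bd j a; omega
            simp only [this, if_true]
            rw [var_const]; positivity
          · refine (var_third _ fun a => ?_).trans ?_
            · split_ifs <;> simp
            · have : tot j v = -1 ∨ tot j v = 0 ∨ tot j v = 1 ∨ tot j v = 2 := by omega
              rcases this with h | h | h | h <;> simp [h]
    _ = walk n (-1) + walk n 0 + walk n 1 + walk n 2 := by
        simp only [Finset.sum_add_distrib, law]
    _ ≤ _ := by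
        have := walk_le n (-1); have := walk_le n 1; have := walk_le n 2
        linarith

lemma P3_wt (z : Fin 3 → Fin 3) (hz : P3 z ≠ 0) : wt 0 (z 0) + wt 1 (z 1) + wt 2 (z 2) = 0 := by
  simp only [P3] at hz
  split_ifs at hz with h
  · rcases h with h | h | h | h | h | h <;> subst h <;> decide
  · exact absurd rfl hz

open Classical in
/-- for the distribution `P3` there are three large sets with
vanishing influences that are never hit simultaneously. -/
theorem three_sets_fail :
    ∀ ε : ℝ, 0 < ε →
    ∃ n₀ : ℕ, ∀ n : ℕ, n₀ < n →
    ∃ S : Fin 3 → Finset (Fin n → Fin 3),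
      (∀ j : Fin 3,
        (0.49 : ℝ) ≤ ∑ x : Fin 3 → Fin n → Fin 3,
          (∏ i, P3 (fun j' => x j' i)) * (if x j ∈ S j then 1 else 0)) ∧
      (∑ x : Fin 3 → Fin n → Fin 3,
          (∏ i, P3 (fun j' => x j' i)) * (if ∀ j, x j ∈ S j then 1 else 0)) = 0 ∧
      (∀ (j : Fin 3) (i : Fin n),
        influence (marginal P3 j) i (fun v => if v ∈ S j then (1:ℝ) else 0) ≤ ε) := by
  intro ε hε
  have hev := walk_tendsto.eventually_lt_const (show (0 : ℝ) < min 0.02 (ε / 4) by positivity)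
  obtain ⟨n₀, hn₀⟩ := Filter.eventually_atTop.1 hev
  refine ⟨n₀, fun n hn => ⟨fun j => Finset.univ.filter (fun v => 0 < tot j v), ?_, ?_, ?_⟩⟩
  · intro j
    have h := (hn₀ n hn.le).trans_le (min_le_left _ _)
    have h1 := prob_pos j n
    rw [← marginalize j] at h1
    simp only [Finset.mem_filter, Finset.mem_univ, true_and]
    have : (0.49 : ℝ) ≤ (1 - walk n 0) / 2 := by norm_num at h ⊢; linarith
    rw [← h1] at this
    convert this
  · refine Finset.sum_eq_zero fun x _ => ?_
    by_cases hp : ∏ i, P3 (fun j' => x j' i) = 0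
    · rw [hp, zero_mul]
    · rw [if_neg, mul_zero]
      intro hx
      simp only [Finset.mem_filter, Finset.mem_univ, true_and] at hx
      have hs : tot 0 (x 0) + tot 1 (x 1) + tot 2 (x 2) = 0 := by
        simp only [tot, ← Finset.sum_add_distrib]
        refine Finset.sum_eq_zero fun i _ => ?_
        exact P3_wt (fun j' => x j' i) (Finset.prod_ne_zero_iff.1 hp i (Finset.mem_univ i))
      have := hx 0; have := hx 1; have := hx 2
      omega
  · intro j i
    have h := (hn₀ n hn.le).trans_le (min_le_right _ _)
    have h1 := infl j n i
    simp only [Finset.mem_filter, Finset.mem_univ, true_and]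
    refine le_trans (le_of_eq ?_) (h1.trans (by linarith))
    congr

end SameSetHitting
end

section
/- Let Ω be a finite set with |Ω| ≥ 2, let P be an ℓ-step probability distribution on Ω^ℓ with equal marginals π (with support all of Ω), let j ∈ [ℓ], and let (X̄^{∖j}, Y, Z) be a double sample on step j from P. Then the supremum, over all functions f : Ω → ℝ with E[f(Y)] = 0 and Var[f(Y)] = 1, of E[f(Y)·f(Z)] equals ρ(P,{j},[ℓ]∖{j})². -/
namespace SameSetHitting

theorem sum_split {Ω : Type} [Fintype Ω] {ℓ : ℕ} (j : Fin ℓ) (F : (Fin ℓ → Ω) → ℝ) :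
    ∑ x, F x = ∑ w : {k : Fin ℓ // k ≠ j} → Ω, ∑ a, F (ins j w a) := by
  rw [← (Equiv.funSplitAt j Ω).symm.sum_comp, Fintype.sum_prod_type_right]
  refine Finset.sum_congr rfl fun w _ => Finset.sum_congr rfl fun a _ => ?_
  congr 1
  funext k
  by_cases h : k = j
  · subst h; simp [ins, Equiv.funSplitAt, Equiv.piSplitAt]
  · simp [ins, Equiv.funSplitAt, Equiv.piSplitAt, h]

theorem ins_self {Ω : Type} {ℓ : ℕ} (j : Fin ℓ) (w : {k : Fin ℓ // k ≠ j} → Ω) (a : Ω) :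
    ins j w a j = a := by simp [ins]

theorem ins_off {Ω : Type} {ℓ : ℕ} (j : Fin ℓ) (w : {k : Fin ℓ // k ≠ j} → Ω) (a : Ω) :
    (fun k : {k : Fin ℓ // k ≠ j} => ins j w a k) = w := by
  funext k
  simp [ins, k.2]

/-- The unnormalized conditional expectation. -/
noncomputable def condA {Ω : Type} [Fintype Ω] {ℓ : ℕ} (P : (Fin ℓ → Ω) → ℝ) (j : Fin ℓ)
    (f : Ω → ℝ) (w : {k : Fin ℓ // k ≠ j} → Ω) : ℝ := ∑ a, P (ins j w a) * f a

theorem expP_prod {Ω : Type} [Fintype Ω] {ℓ : ℕ} (P : (Fin ℓ → Ω) → ℝ) (j : Fin ℓ)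
    (f : Ω → ℝ) (g : ({k : Fin ℓ // k ≠ j} → Ω) → ℝ) :
    expP P (fun x => f (x j) * g (fun k => x k)) = ∑ w, condA P j f w * g w := by
  unfold expP condA
  rw [sum_split j]
  refine Finset.sum_congr rfl fun w _ => ?_
  rw [Finset.sum_mul]
  refine Finset.sum_congr rfl fun a _ => ?_
  simp only [ins_self, ins_off]; ring

theorem expP_off {Ω : Type} [Fintype Ω] {ℓ : ℕ} (P : (Fin ℓ → Ω) → ℝ) (j : Fin ℓ)
    (g : ({k : Fin ℓ // k ≠ j} → Ω) → ℝ) :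
    expP P (fun x => g (fun k => x k)) = ∑ w, margOff P j w * g w := by
  have := expP_prod P j (fun _ => 1) g
  simpa [condA, margOff] using this

theorem expP_at {Ω : Type} [Fintype Ω] {ℓ : ℕ} {P : (Fin ℓ → Ω) → ℝ} {π : Ω → ℝ}
    (hm : HasMarginals P π) (j : Fin ℓ) (f : Ω → ℝ) :
    expP P (fun x => f (x j)) = expPi π f := by
  classical
  unfold expP expPi
  simp_rw [← hm j, marginal, Finset.sum_mul]
  rw [Finset.sum_comm]
  refine Finset.sum_congr rfl fun x _ => ?_
  simp [ite_mul]

theorem margOff_nonneg {Ω : Type} [Fintype Ω] {ℓ : ℕ} {P : (Fin ℓ → Ω) → ℝ}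
    (hP : IsDist P) (j : Fin ℓ) (w : {k : Fin ℓ // k ≠ j} → Ω) : 0 ≤ margOff P j w :=
  Finset.sum_nonneg fun _ _ => hP.1 _

theorem condA_zero {Ω : Type} [Fintype Ω] {ℓ : ℕ} {P : (Fin ℓ → Ω) → ℝ}
    (hP : IsDist P) (j : Fin ℓ) (f : Ω → ℝ) (w : {k : Fin ℓ // k ≠ j} → Ω)
    (h : margOff P j w = 0) : condA P j f w = 0 := by
  unfold margOff at h
  rw [Finset.sum_eq_zero_iff_of_nonneg fun _ _ => hP.1 _] at h
  exact Finset.sum_eq_zero fun a _ => by rw [h a (Finset.mem_univ _), zero_mul]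

theorem double_eq {Ω : Type} [Fintype Ω] {ℓ : ℕ} (P : (Fin ℓ → Ω) → ℝ) (j : Fin ℓ)
    (f : Ω → ℝ) :
    ∑ y : Ω, ∑ z : Ω, doubleSample P j y z * (f y * f z)
      = ∑ w, condA P j f w ^ 2 / margOff P j w := by
  have : ∀ y z, doubleSample P j y z * (f y * f z) =
      ∑ w, (P (ins j w y) * f y) * (P (ins j w z) * f z) / margOff P j w := by
    intro y z
    unfold doubleSample
    rw [Finset.sum_mul]
    refine Finset.sum_congr rfl fun w _ => ?_
    split_ifs with h
    · simp [h]
    · ring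
  simp_rw [this]
  rw [Finset.sum_congr rfl fun y _ => Finset.sum_comm, Finset.sum_comm]
  refine Finset.sum_congr rfl fun w _ => ?_
  unfold condA
  rw [sq, Finset.sum_mul_sum, Finset.sum_div]
  simp_rw [Finset.sum_div]

theorem varPi_of_zero {Ω : Type} [Fintype Ω] (π : Ω → ℝ) (f : Ω → ℝ) (h : expPi π f = 0) :
    varPi π f = expPi π (fun a => f a * f a) := by
  unfold varPi
  rw [h]
  simp [sq]

theorem expP_const {Ω : Type} [Fintype Ω] {ℓ : ℕ} {P : (Fin ℓ → Ω) → ℝ}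
    (hP : IsDist P) (c : ℝ) : expP P (fun _ => c) = c := by
  unfold expP
  rw [← Finset.sum_mul, hP.2, one_mul]

theorem covP_center {Ω : Type} [Fintype Ω] {ℓ : ℕ} {P : (Fin ℓ → Ω) → ℝ}
    (hP : IsDist P) (f g : (Fin ℓ → Ω) → ℝ) :
    covP P f g = expP P (fun x => (f x - expP P f) * (g x - expP P g)) := by
  have h : ∀ a b : ℝ, expP P (fun x => (f x - a) * (g x - b)) =
      expP P (fun x => f x * g x) - b * expP P f - a * expP P g + a * b := by
    intro a b
    have h1 : a * b = ∑ x, P x * (a * b) := by rw [← Finset.sum_mul, hP.2, one_mul]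
    rw [h1]
    unfold expP
    rw [Finset.mul_sum, Finset.mul_sum, ← Finset.sum_sub_distrib, ← Finset.sum_sub_distrib,
      ← Finset.sum_add_distrib]
    exact Finset.sum_congr rfl fun x _ => by ring
  rw [h, covP]; ring

theorem covP_le {Ω : Type} [Fintype Ω] {ℓ : ℕ} {P : (Fin ℓ → Ω) → ℝ}
    (hP : IsDist P) (f g : (Fin ℓ → Ω) → ℝ) (hf : varP P f = 1) (hg : varP P g = 1) :
    covP P f g ≤ 1 := by
  rw [varP, covP_center hP] at hf hg
  rw [covP_center hP]
  have : (1:ℝ) = (1 + 1) / 2 := by norm_num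
  rw [this]
  nth_rw 1 [← hf]
  rw [← hg]
  unfold expP
  rw [← Finset.sum_add_distrib, Finset.sum_div]
  refine Finset.sum_le_sum fun x _ => ?_
  set u := f x - ∑ x, P x * f x
  set v := g x - ∑ x, P x * g x
  nlinarith [mul_nonneg (hP.1 x) (sq_nonneg (u - v))]

/-- the second eigenvalue characterization of the double sample,
`λ₂(K) = ρ(P, {j}, [ℓ]∖{j})²`. -/
theorem double_sample_sup_eq_rho_sq
    {Ω : Type} [Fintype Ω] {ℓ : ℕ} (hΩ : 2 ≤ Fintype.card Ω)
    (P : (Fin ℓ → Ω) → ℝ) (π : Ω → ℝ)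
    (hP : IsDist P) (hm : HasMarginals P π) (hπ : ∀ a : Ω, 0 < π a)
    (j : Fin ℓ) :
    sSup {r : ℝ | ∃ f : Ω → ℝ, expPi π f = 0 ∧ varPi π f = 1 ∧
        r = ∑ y : Ω, ∑ z : Ω, doubleSample P j y z * (f y * f z)}
      = rhoST P {j} ({j}ᶜ) ^ 2 := by
  obtain ⟨a0⟩ : Nonempty Ω := Fintype.card_pos_iff.mp (by omega)
  set R : Set ℝ := {r : ℝ | ∃ f g : (Fin ℓ → Ω) → ℝ, DependsOn f {j} ∧ DependsOn g ({j}ᶜ) ∧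
    varP P f = 1 ∧ varP P g = 1 ∧ r = covP P f g} with hR
  have hrho : rhoST P {j} ({j}ᶜ) = sSup R := rfl
  rw [hrho]
  have hbdd : BddAbove R := by
    refine ⟨1, ?_⟩
    rintro r ⟨f, g, -, -, hf, hg, rfl⟩
    exact covP_le hP f g hf hg
  have hR0 : 0 ≤ sSup R := by
    rcases R.eq_empty_or_nonempty with h | ⟨r, hr⟩
    · rw [h, Real.sSup_empty]
    · have hr' : -r ∈ R := by
        obtain ⟨f, g, h1, h2, h3, h4, rfl⟩ := hr
        refine ⟨f, fun x => - g x, h1, fun x y h => by simp only [h2 x y h], h3, ?_, ?_⟩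
        · rw [← h4]; simp [varP, covP, expP]
        · simp [covP, expP]; ring
      rcases le_total 0 r with h | h
      · exact Real.sSup_nonneg' ⟨r, hr, h⟩
      · exact Real.sSup_nonneg' ⟨-r, hr', by linarith⟩
  simp_rw [double_eq]
  have hm0 := margOff_nonneg hP j
  have hle : ∀ f : Ω → ℝ, expPi π f = 0 → varPi π f = 1 →
      ∑ w, condA P j f w ^ 2 / margOff P j w ≤ sSup R ^ 2 := by
    intro f hf0 hf1
    set D := ∑ w, condA P j f w ^ 2 / margOff P j w with hD
    have hD0 : 0 ≤ D := Finset.sum_nonneg fun w _ => div_nonneg (sq_nonneg _) (hm0 w)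
    rcases hD0.eq_or_lt with h | hDpos
    · rw [← h]; positivity
    have hs : 0 < √D := Real.sqrt_pos.mpr hDpos
    have hss : √D * √D = D := Real.mul_self_sqrt hD0
    let γ : ({k : Fin ℓ // k ≠ j} → Ω) → ℝ := fun w => condA P j f w / margOff P j w / √D
    have hmg : ∀ w, margOff P j w * γ w = condA P j f w / √D := by
      intro w
      simp only [γ]
      by_cases h : margOff P j w = 0
      · rw [h, condA_zero hP j f w h]; simp
      · field_simp
    have hE1 : expP P (fun x => f (x j)) = 0 := by rw [expP_at hm, hf0]
    have hE2 : expP P (fun x => γ (fun k => x k)) = 0 := by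
      rw [expP_off]
      simp_rw [hmg]
      have := expP_prod P j f (fun _ => 1)
      simp only [mul_one] at this
      rw [← Finset.sum_div, ← this, hE1, zero_div]
    have hV : varP P (fun x => γ (fun k => x k)) = 1 := by
      rw [varP, covP, hE2, expP_off P j (fun w => γ w * γ w)]
      simp_rw [← mul_assoc, hmg]
      have : ∀ w, condA P j f w / √D * γ w = condA P j f w ^ 2 / margOff P j w / D := by
        intro w
        simp only [γ]
        have hi : D⁻¹ = (√D)⁻¹ * (√D)⁻¹ := by rw [← mul_inv, hss]
        simp only [div_eq_mul_inv, hi]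
        ring
      simp_rw [this]
      rw [← Finset.sum_div, ← hD, div_self hDpos.ne']; ring
    have hC : √D = covP P (fun x => f (x j)) (fun x => γ (fun k => x k)) := by
      rw [covP, hE2, expP_prod]
      have : ∀ w, condA P j f w * γ w = condA P j f w ^ 2 / margOff P j w / √D := by
        intro w
        simp only [γ, div_eq_mul_inv]
        ring
      simp_rw [this]
      rw [← Finset.sum_div, ← hD]
      field_simp
      rw [sq, hss]; ring
    have hmem : √D ∈ R := by
      refine ⟨_, _, ?_, ?_, ?_, hV, hC⟩
      · intro x y h
        simp only [h j (by simp)]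
      · intro x y h
        have : (fun k : {k : Fin ℓ // k ≠ j} => x k) = fun k : {k : Fin ℓ // k ≠ j} => y k := by
          funext k
          exact h k (by simp [k.2])
        simp only [this]
      · rw [varP, covP, hE1, expP_at hm j (fun a => f a * f a), ← varPi_of_zero π f hf0, hf1]
        ring
    have := le_csSup hbdd hmem
    nlinarith
  apply le_antisymm
  · apply Real.sSup_le _ (sq_nonneg _)
    rintro r ⟨f, h0, h1, rfl⟩
    exact hle f h0 h1
  · set T : Set ℝ := {r : ℝ | ∃ f : Ω → ℝ, expPi π f = 0 ∧ varPi π f = 1 ∧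
      r = ∑ w, condA P j f w ^ 2 / margOff P j w} with hT
    have hTb : BddAbove T := by
      refine ⟨sSup R ^ 2, ?_⟩
      rintro r ⟨f, h0, h1, rfl⟩
      exact hle f h0 h1
    have hT0 : 0 ≤ sSup T := by
      apply Real.sSup_nonneg
      rintro r ⟨f, h0, h1, rfl⟩
      exact Finset.sum_nonneg fun w _ => div_nonneg (sq_nonneg _) (hm0 w)
    have hkey : sSup R ≤ √(sSup T) := by
      apply Real.sSup_le _ (Real.sqrt_nonneg _)
      rintro r ⟨f, g, hf, hg, hvf, hvg, rfl⟩
      apply Real.le_sqrt_of_sq_le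
      rw [varP, covP_center hP] at hvf hvg
      rw [covP_center hP]
      set cf := expP P f with hcf
      set cg := expP P g
      let φ : Ω → ℝ := fun a => f (fun _ => a) - cf
      let γ : ({k : Fin ℓ // k ≠ j} → Ω) → ℝ := fun w => g (ins j w a0) - cg
      have hφ : ∀ x, f x - cf = φ (x j) := fun x => by
        simp only [φ]
        rw [hf x (fun _ => x j)]
        intro k hk
        rw [Finset.mem_singleton.mp hk]
      have hγ : ∀ x, g x - cg = γ (fun k => x k) := fun x => by
        simp only [γ]
        rw [hg x]
        intro k hk
        have : k ≠ j := by simpa using hk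
        simp [ins, this]
      have hφ0 : expPi π φ = 0 := by
        rw [← expP_at hm j φ]
        simp_rw [← hφ]
        have h1 : expP P (fun x => f x - cf) = expP P f - expP P (fun _ => cf) := by
          unfold expP
          rw [← Finset.sum_sub_distrib]
          exact Finset.sum_congr rfl fun x _ => by ring
        rw [h1, expP_const hP]
        exact sub_self _
      simp_rw [hφ] at hvf
      simp_rw [hγ] at hvg
      simp_rw [hφ, hγ]
      rw [expP_at hm j (fun a => φ a * φ a), ← varPi_of_zero π φ hφ0] at hvf
      rw [expP_off P j (fun w => γ w * γ w)] at hvg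
      rw [expP_prod]
      refine le_trans ?_ (le_csSup hTb ⟨φ, hφ0, hvf, rfl⟩)
      have hCS := Finset.sum_sq_le_sum_mul_sum_of_sq_le_mul Finset.univ
        (r := fun w => condA P j φ w * γ w)
        (f := fun w => condA P j φ w ^ 2 / margOff P j w)
        (g := fun w => margOff P j w * (γ w * γ w))
        (fun w _ => div_nonneg (sq_nonneg _) (hm0 w))
        (fun w _ => mul_nonneg (hm0 w) (mul_self_nonneg _))
        (fun w _ => by
          by_cases h : margOff P j w = 0
          · rw [condA_zero hP j φ w h]; simp
          · apply le_of_eq; field_simp)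
      rwa [hvg, mul_one] at hCS
    calc sSup R ^ 2 ≤ √(sSup T) ^ 2 := by gcongr
      _ = sSup T := Real.sq_sqrt hT0

end SameSetHitting
end

section
/- Let Ω be a finite set, π a probability distribution on Ω with support all of Ω, α(π) := min_{x∈Ω} π(x), and let X have law πⁿ. If a function f : Ωⁿ → [0,1] is ε-upper resilient up to size k, then f is ε′-resilient up to size k, where ε′ = ε/α(π)^k. -/
namespace SameSetHitting

/-- Take the coordinates with `b i = true` from `z`, the others from `x`. -/
def mixc {Ω : Type} {n : ℕ} (b : Fin n → Bool) (z x : Fin n → Ω) : Fin n → Ω :=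
  fun i => if b i then z i else x i

/-- Swapping the coordinates selected by `b`. -/
def mixEquiv {Ω : Type} {n : ℕ} (b : Fin n → Bool) :
    ((Fin n → Ω) × (Fin n → Ω)) ≃ ((Fin n → Ω) × (Fin n → Ω)) where
  toFun p := (mixc b p.1 p.2, mixc b p.2 p.1)
  invFun p := (mixc b p.1 p.2, mixc b p.2 p.1)
  left_inv p := by
    ext i <;> simp only [mixc] <;> split_ifs <;> rfl
  right_inv p := by
    ext i <;> simp only [mixc] <;> split_ifs <;> rfl

lemma sum_weight {Ω : Type} [Fintype Ω] {n : ℕ} (π : Ω → ℝ) (h : ∑ a, π a = 1) :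
    ∑ v : Fin n → Ω, ∏ i, π (v i) = 1 := by
  classical
  have := Finset.prod_univ_sum (fun _ : Fin n => (Finset.univ : Finset Ω)) (fun _ a => π a)
  simp only [h, Finset.prod_const_one, Fintype.piFinset_univ] at this
  exact this.symm

lemma exps_mix {Ω : Type} [Fintype Ω] {n : ℕ} (π : Ω → ℝ) (h : ∑ a, π a = 1)
    (b : Fin n → Bool) (f : (Fin n → Ω) → ℝ) :
    ∑ z : Fin n → Ω, (∏ i, π (z i)) * exps π (fun x => f (mixc b z x)) = exps π f := by
  have h1 : ∑ p : (Fin n → Ω) × (Fin n → Ω),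
      ((∏ i, π (p.1 i)) * (∏ i, π (p.2 i))) * f (mixc b p.1 p.2)
      = ∑ p : (Fin n → Ω) × (Fin n → Ω),
      ((∏ i, π (p.1 i)) * (∏ i, π (p.2 i))) * f p.1 := by
    refine Fintype.sum_equiv (mixEquiv b) _ _ ?_
    rintro ⟨z, x⟩
    simp only [mixEquiv, Equiv.coe_fn_mk, ← Finset.prod_mul_distrib]
    congr 1
    refine Finset.prod_congr rfl fun i _ => ?_
    simp only [mixc]
    split_ifs
    · rfl
    · exact mul_comm _ _
  rw [Fintype.sum_prod_type, Fintype.sum_prod_type] at h1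
  have h2 : ∀ z : Fin n → Ω, ∑ x : Fin n → Ω,
      ((∏ i, π (z i)) * (∏ i, π (x i))) * f z = (∏ i, π (z i)) * f z := by
    intro z
    rw [← Finset.sum_mul, ← Finset.mul_sum, sum_weight π h, mul_one]
  simp only [h2] at h1
  unfold exps
  rw [← h1]
  refine Finset.sum_congr rfl fun z _ => ?_
  rw [Finset.mul_sum]
  refine Finset.sum_congr rfl fun x _ => ?_
  ring

open Classical in
/-- Probability bound for agreeing with the restriction. -/
lemma agree_prob {Ω : Type} [Fintype Ω] {n : ℕ} (π : Ω → ℝ) (h : ∑ a, π a = 1)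
    (hpos : ∀ a, 0 ≤ π a) (α : ℝ) (hα0 : 0 ≤ α) (hα1 : α ≤ 1) (hα : ∀ a, α ≤ π a)
    (R : Fin n → Option Ω) (k : ℕ) (hk : restSize R ≤ k) :
    α ^ k ≤ ∑ z : Fin n → Ω, ∏ i, (if R i = none ∨ R i = some (z i) then π (z i) else 0) := by
  have := Finset.prod_univ_sum (fun _ : Fin n => (Finset.univ : Finset Ω))
    (fun i a => if R i = none ∨ R i = some a then π a else 0)
  rw [Fintype.piFinset_univ] at this
  rw [← this]
  calc α ^ k ≤ α ^ restSize R := pow_le_pow_of_le_one hα0 hα1 hk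
    _ = ∏ i, (if (R i).isSome = true then α else 1) := by
      rw [Finset.prod_ite, Finset.prod_const, Finset.prod_const_one, mul_one]; rfl
    _ ≤ _ := by
      refine Finset.prod_le_prod (fun i _ => by split_ifs <;> linarith) fun i _ => ?_
      cases hR : R i with
      | none => simp [h]
      | some r => simpa using hα r

/-- ε-upper resilience up to size `k` implies
`ε/α(π)^k`-resilience up to size `k`. -/
theorem upper_resilient_implies_resilient
    {Ω : Type} [Fintype Ω] [Nonempty Ω] {n : ℕ}
    (π : Ω → ℝ) (hπd : IsDist π) (hπ : ∀ a : Ω, 0 < π a)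
    (f : (Fin n → Ω) → ℝ) (hf : ∀ v, f v ∈ Set.Icc (0:ℝ) 1)
    (ε : ℝ) (k : ℕ)
    (hup : ∀ R : Fin n → Option Ω, restSize R ≤ k →
      exps π (restrict R f) ≤ (1 + ε) * exps π f) :
    Resilient π (ε / (⨅ x : Ω, π x) ^ k) k f := by
  classical
  set α := ⨅ x : Ω, π x with hαdef
  have hα : ∀ a, α ≤ π a := fun a => ciInf_le (Set.finite_range π).bddBelow a
  have hα0 : 0 < α := by
    obtain ⟨a, ha⟩ := exists_eq_ciInf_of_finite (f := π)
    rw [hαdef, ← ha]; exact hπ a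
  have hα1 : α ≤ 1 := by
    obtain ⟨a⟩ := ‹Nonempty Ω›
    refine (hα a).trans ?_
    rw [← hπd.2]
    exact Finset.single_le_sum (fun x _ => hπd.1 x) (Finset.mem_univ a)
  have hE0 : 0 ≤ exps π f :=
    Finset.sum_nonneg fun v _ => mul_nonneg (Finset.prod_nonneg fun i _ => hπd.1 _) (hf v).1
  have hεE : 0 ≤ ε * exps π f := by
    have h0 := hup (fun _ => none) (by simp [restSize])
    have h1 : restrict (fun _ => none) f = f := by
      funext x; simp [restrict]
    rw [h1] at h0
    linarith
  have hαk0 : 0 < α ^ k := pow_pos hα0 k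
  have hαk1 : α ^ k ≤ 1 := pow_le_one₀ hα0.le hα1
  intro R hR
  have hrw : ε / α ^ k * exps π f = ε * exps π f / α ^ k := by ring
  constructor
  · set p := ∑ z : Fin n → Ω,
      ∏ i, (if R i = none ∨ R i = some (z i) then π (z i) else 0) with hp
    have hpk : α ^ k ≤ p := agree_prob π hπd.2 hπd.1 α hα0.le hα1 hα R k hR
    have hp0 : 0 < p := hαk0.trans_le hpk
    have key : exps π f ≤ p * exps π (restrict R f) + (1 - p) * ((1 + ε) * exps π f) := by
      rw [← sum_weight (n := n) π hπd.2, hp, ← Finset.sum_sub_distrib, Finset.sum_mul,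
        Finset.sum_mul, ← Finset.sum_add_distrib]
      conv_lhs => rw [← exps_mix π hπd.2 (fun i => (R i).isSome) f]
      refine Finset.sum_le_sum fun z _ => ?_
      by_cases hz : ∀ i, R i = none ∨ R i = some (z i)
      · have e1 : (∏ i, (if R i = none ∨ R i = some (z i) then π (z i) else 0))
            = ∏ i, π (z i) := Finset.prod_congr rfl fun i _ => if_pos (hz i)
        have e2 : (fun x => f (mixc (fun i => (R i).isSome) z x)) = restrict R f := by
          funext x
          unfold restrict
          congr 1
          funext i
          rcases hz i with h | h <;> simp [mixc, h]
        rw [e1, e2]; simp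
      · have e1 : (∏ i, (if R i = none ∨ R i = some (z i) then π (z i) else 0)) = 0 := by
          obtain ⟨i, hi⟩ := not_forall.mp hz
          exact Finset.prod_eq_zero (Finset.mem_univ i) (if_neg hi)
        rw [e1, zero_mul, zero_add, sub_zero]
        refine mul_le_mul_of_nonneg_left ?_ (Finset.prod_nonneg fun i _ => hπd.1 _)
        have e2 : (fun x => f (mixc (fun i => (R i).isSome) z x))
            = restrict (fun i => if (R i).isSome then some (z i) else none) f := by
          funext x
          unfold restrict
          congr 1
          funext i
          simp only [mixc]
          split_ifs <;> rfl
        rw [e2, sum_weight π hπd.2]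
        apply hup
        refine le_trans (le_of_eq ?_) hR
        unfold restSize
        congr 1
        ext i
        cases h : R i <;> simp [h]
    have h2 : exps π f - exps π (restrict R f) ≤ ε * exps π f / p := by
      rw [le_div_iff₀ hp0]
      nlinarith [mul_nonneg hp0.le hεE]
    have h3 : ε * exps π f / p ≤ ε * exps π f / α ^ k :=
      div_le_div_of_nonneg_left hεE hαk0 hpk
    rw [sub_mul, hrw]
    linarith
  · have h1 := hup R hR
    have h2 : ε * exps π f ≤ ε * exps π f / α ^ k := le_div_self hεE hαk0 hαk1
    rw [add_mul, hrw]
    linarith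


end SameSetHitting
end
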